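/- arXiv:2501.03216 — 9 statements merged into one kernel-verified Lean document; each statement's English description precedes it below -/
import Mathlib

section
/- For every integer r ≥ 3 and every positive integer n, every collection of n matchings, each of size n, in an r-uniform hypergraph admits a rainbow matching of size m satisfying (r+1)·m ≥ 2n − binom(2r, r); equivalently, g'(r,n) ≥ 2n/(r+1) − binom(2r,r)/(r+1). -/
/-- `A` is a matching consisting of `r`-element edges: every edge has exactly `r`
vertices and distinct edges are pairwise disjoint. -/
def IsMatching {V : Type*} (r : ℕ) (A : Finset (Finset V)) : Prop :=
  (∀ e ∈ A, e.card = r) ∧ ∀ e ∈ A, ∀ f ∈ A, e ≠ f → Disjoint e f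

/-- The collection of matchings `M 0, …, M (n-1)` admits a rainbow matching of size `s`:
there are `s` pairwise disjoint edges together with an injective assignment of colours
such that each edge lies in the matching of its assigned colour. -/
def HasRainbow {V : Type*} {n : ℕ} (M : Fin n → Finset (Finset V)) (s : ℕ) : Prop :=
  ∃ (c : Fin s → Fin n) (e : Fin s → Finset V),
    Function.Injective c ∧ (∀ j, e j ∈ M (c j)) ∧
      ∀ j k, j ≠ k → Disjoint (e j) (e k)

/-- With respect to the partition of the vertex set given by `P : V → Fin r`,
the edge `e` contains exactly one vertex from each part. -/
def IsPartiteEdge {V : Type*} (r : ℕ) (P : V → Fin r) (e : Finset V) : Prop :=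
  ∀ k : Fin r, (e.filter fun v => P v = k).card = 1

open Finset in
/-- Removing, in all possible ways, a point outside `A` from the ground set `X` of a pair of
disjoint sets `A`, `B` leaves the Bollobás weight unchanged on average. -/
theorem sum_sdiff_inv_choose_erase {α : Type*} [DecidableEq α] {X A B : Finset α}
    (hA : A ⊆ X) (hB : B ⊆ X) (hAB : Disjoint A B) (hne : B.Nonempty) :
    ∑ x ∈ X \ A, (((#A + #(B.erase x)).choose #A : ℕ) : ℚ)⁻¹ =
      #X * (((#A + #B).choose #A : ℕ) : ℚ)⁻¹ := by
  have hBX : B ⊆ X \ A := subset_sdiff.2 ⟨hB, hAB.symm⟩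
  rw [← sum_sdiff hBX]
  have outside : ∑ x ∈ (X \ A) \ B, (((#A + #(B.erase x)).choose #A : ℕ) : ℚ)⁻¹ =
      ∑ x ∈ (X \ A) \ B, (((#A + #B).choose #A : ℕ) : ℚ)⁻¹ :=
    sum_congr rfl fun x hx => by rw [erase_eq_of_notMem (mem_sdiff.1 hx).2]
  have inside : ∑ x ∈ B, (((#A + #(B.erase x)).choose #A : ℕ) : ℚ)⁻¹ =
      ∑ x ∈ B, (((#A + (#B - 1)).choose #A : ℕ) : ℚ)⁻¹ :=
    sum_congr rfl fun x hx => by rw [card_erase_of_mem hx]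
  rw [outside, inside, sum_const, sum_const, card_sdiff_of_subset hBX, card_sdiff_of_subset hA,
    nsmul_eq_mul, nsmul_eq_mul]
  have hle : #B ≤ #X - #A := (card_le_card hBX).trans_eq (card_sdiff_of_subset hA)
  have hAX : #A ≤ #X := card_le_card hA
  obtain ⟨b, hb⟩ : ∃ b, #B = b + 1 := ⟨#B - 1, by have := hne.card_pos; omega⟩
  rw [Nat.cast_sub hle, Nat.cast_sub hAX, hb]
  have key := Nat.choose_mul_succ_eq (#A + b) #A
  rw [show #A + b + 1 - #A = b + 1 by omega, add_assoc] at key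
  have key' : (((#A + b).choose #A : ℕ) : ℚ) * (#A + (b + 1)) =
      ((#A + (b + 1)).choose #A : ℕ) * (b + 1) := by exact_mod_cast key
  have h₁ : (((#A + b).choose #A : ℕ) : ℚ) ≠ 0 := by
    exact_mod_cast (Nat.choose_pos (Nat.le_add_right _ _)).ne'
  have h₂ : (((#A + (b + 1)).choose #A : ℕ) : ℚ) ≠ 0 := by
    exact_mod_cast (Nat.choose_pos (Nat.le_add_right _ _)).ne'
  rw [Nat.add_sub_cancel]
  field_simp
  push_cast
  linear_combination -key'

open Finset in
/-- **Bollobás set pairs inequality.** -/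
theorem sum_inv_choose_le_one {α ι : Type*} [DecidableEq α] (X : Finset α) (I : Finset ι)
    (A B : ι → Finset α) (hA : ∀ i ∈ I, A i ⊆ X) (hB : ∀ i ∈ I, B i ⊆ X)
    (hAB : ∀ i ∈ I, Disjoint (A i) (B i))
    (hcross : ∀ i ∈ I, ∀ j ∈ I, i ≠ j → ¬ Disjoint (A i) (B j)) :
    ∑ i ∈ I, (((#(A i) + #(B i)).choose #(A i) : ℕ) : ℚ)⁻¹ ≤ 1 := by
  classical
  induction X using Finset.strongInduction generalizing I B with
  | H X ih =>
    by_cases hempty : ∃ j ∈ I, B j = ∅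
    · obtain ⟨j, hj, hBj⟩ := hempty
      have hI : I = {j} := by
        refine eq_singleton_iff_unique_mem.2 ⟨hj, fun i hi => ?_⟩
        by_contra hij
        exact hcross i hi j hj hij (by simp [hBj])
      simp [hI, hBj]
    push Not at hempty
    rcases X.eq_empty_or_nonempty with rfl | hX
    · have hI : I = ∅ := by
        refine eq_empty_of_forall_notMem fun i hi => ?_
        exact (hempty i hi).ne_empty (subset_empty.1 (hB i hi))
      simp [hI]
    have hpos : (0 : ℚ) < #X := by exact_mod_cast hX.card_pos
    refine le_of_mul_le_mul_left ?_ hpos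
    calc (#X : ℚ) * ∑ i ∈ I, (((#(A i) + #(B i)).choose #(A i) : ℕ) : ℚ)⁻¹
        = ∑ i ∈ I, ∑ x ∈ X \ A i, (((#(A i) + #((B i).erase x)).choose #(A i) : ℕ) : ℚ)⁻¹ := by
          rw [mul_sum]
          exact sum_congr rfl fun i hi =>
            (sum_sdiff_inv_choose_erase (hA i hi) (hB i hi) (hAB i hi) (hempty i hi)).symm
      _ = ∑ x ∈ X, ∑ i ∈ I with x ∉ A i,
            (((#(A i) + #((B i).erase x)).choose #(A i) : ℕ) : ℚ)⁻¹ :=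
          sum_comm' fun i x => by simp only [mem_sdiff, mem_filter]; tauto
      _ ≤ ∑ x ∈ X, (1 : ℚ) := by
          refine sum_le_sum fun x hx => ih (X.erase x) (erase_ssubset hx) _
            (fun i => (B i).erase x) ?_ ?_ ?_ ?_
          · intro i hi
            rw [mem_filter] at hi
            exact subset_erase.2 ⟨hA i hi.1, hi.2⟩
          · intro i hi
            exact erase_subset_erase x (hB i (mem_filter.1 hi).1)
          · intro i hi
            exact (hAB i (mem_filter.1 hi).1).mono_right (erase_subset _ _)
          · intro i hi j hj hij hdis
            rw [mem_filter] at hi hj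
            refine hcross i hi.1 j hj.1 hij (disjoint_left.2 fun y hyA hyB => ?_)
            refine disjoint_left.1 hdis hyA (mem_erase.2 ⟨?_, hyB⟩)
            rintro rfl
            exact hi.2 hyA
      _ = #X * 1 := by simp

open Finset in
/-- If each index of `T` comes with two disjoint `r`-sets and sets belonging to distinct indices
intersect, then `T` has at most half of `(2 * r).choose r` elements. -/
theorem two_mul_card_le_choose {α ι : Type*} {r : ℕ} (hr : 0 < r)
    (T : Finset ι) (f g : ι → Finset α)
    (hf : ∀ i ∈ T, #(f i) = r) (hg : ∀ i ∈ T, #(g i) = r) (hfg : ∀ i ∈ T, Disjoint (f i) (g i))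
    (hcross : ∀ i ∈ T, ∀ j ∈ T, i ≠ j → ∀ s ∈ ({f i, g i} : Set (Finset α)),
      ∀ t ∈ ({f j, g j} : Set (Finset α)), ¬ Disjoint s t) :
    2 * #T ≤ (2 * r).choose r := by
  classical
  let A : ι × Bool → Finset α := fun p => if p.2 then f p.1 else g p.1
  let B : ι × Bool → Finset α := fun p => if p.2 then g p.1 else f p.1
  have cardA : ∀ p ∈ T ×ˢ (univ : Finset Bool), #(A p) = r := by
    rintro ⟨i, _ | _⟩ hp
    · simpa [A] using hg i (by simpa using hp)
    · simpa [A] using hf i (by simpa using hp)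
  have cardB : ∀ p ∈ T ×ˢ (univ : Finset Bool), #(B p) = r := by
    rintro ⟨i, _ | _⟩ hp
    · simpa [B] using hf i (by simpa using hp)
    · simpa [B] using hg i (by simpa using hp)
  have memA : ∀ p, A p ∈ ({f p.1, g p.1} : Set (Finset α)) := by
    rintro ⟨i, _ | _⟩ <;> simp [A]
  have memB : ∀ p, B p ∈ ({f p.1, g p.1} : Set (Finset α)) := by
    rintro ⟨i, _ | _⟩ <;> simp [B]
  have hmain := sum_inv_choose_le_one
    ((T ×ˢ univ).biUnion A ∪ (T ×ˢ univ).biUnion B) (T ×ˢ univ) A B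
    (fun p hp => (subset_biUnion_of_mem A hp).trans subset_union_left)
    (fun p hp => (subset_biUnion_of_mem B hp).trans subset_union_right)
    (by
      rintro ⟨i, _ | _⟩ hp
      · simpa [A, B] using (hfg i (by simpa using hp)).symm
      · simpa [A, B] using hfg i (by simpa using hp))
    (by
      rintro p hp q hq hpq
      by_cases h : p.1 = q.1
      · have hAB : B q = A p := by
          obtain ⟨i, b⟩ := p
          obtain ⟨j, c⟩ := q
          cases b <;> cases c <;> simp_all [A, B]
        rw [hAB, disjoint_self, bot_eq_empty, ← card_eq_zero, cardA p hp]
        exact hr.ne'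
      · exact hcross _ (mem_product.1 hp).1 _ (mem_product.1 hq).1 h _ (memA p) _ (memB q))
  rw [sum_congr rfl fun p hp => by rw [cardA p hp, cardB p hp], sum_const, card_product,
    card_univ, Fintype.card_bool, nsmul_eq_mul, ← two_mul r] at hmain
  have hpos : (0 : ℚ) < ((2 * r).choose r : ℕ) := by
    exact_mod_cast Nat.choose_pos (by omega)
  rw [← div_eq_mul_inv, div_le_one hpos] at hmain
  rw [mul_comm]
  exact_mod_cast hmain

open Finset in
/-- The edges of a matching meet a set `U` in at most `#U` vertices altogether. -/
theorem IsMatching.sum_card_inter_le {V : Type*} [DecidableEq V] {r : ℕ}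
    {A : Finset (Finset V)} (hA : IsMatching r A) (U : Finset V) :
    ∑ f ∈ A, #(f ∩ U) ≤ #U := by
  rw [← card_biUnion]
  · exact card_le_card (biUnion_subset.2 fun f _ => inter_subset_right)
  · intro f hf g hg hfg
    exact (hA.2 f hf g hg hfg).mono inter_subset_left inter_subset_left

/-- The edges `e j` with colours `c j` form a rainbow matching. -/
def IsRainbow {V : Type*} {n m : ℕ} (M : Fin n → Finset (Finset V))
    (c : Fin m → Fin n) (e : Fin m → Finset V) : Prop :=
  Function.Injective c ∧ (∀ j, e j ∈ M (c j)) ∧ ∀ j k, j ≠ k → Disjoint (e j) (e k)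

namespace IsRainbow

variable {V : Type*} {n m r : ℕ} {M : Fin n → Finset (Finset V)} {c : Fin m → Fin n}
  {e : Fin m → Finset V}

/-- A rainbow matching can be enlarged by a disjoint edge of an unused colour. -/
theorem extend (h : IsRainbow M c e) {i : Fin n} {f : Finset V} (hi : ∀ j, c j ≠ i)
    (hf : f ∈ M i) (hdis : ∀ j, Disjoint f (e j)) : HasRainbow M (m + 1) := by
  refine ⟨Fin.cons i c, Fin.cons f e, ?_, ?_, ?_⟩
  · exact Fin.cons_injective_iff.2 ⟨fun ⟨j, hj⟩ => hi j hj, h.1⟩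
  · exact Fin.cases hf h.2.1
  · refine Fin.cases (Fin.cases (fun h => absurd rfl h) fun k _ => hdis k) fun j => ?_
    refine Fin.cases (fun _ => (hdis j).symm) fun k hjk => h.2.2 j k fun hjk' => hjk (by rw [hjk'])

/-- An edge of a rainbow matching can be exchanged for an edge of an unused colour that is
disjoint from all the other edges. -/
theorem update (h : IsRainbow M c e) {k : Fin m} {i : Fin n} {f : Finset V}
    (hi : ∀ j, c j ≠ i) (hf : f ∈ M i) (hdis : ∀ j, j ≠ k → Disjoint f (e j)) :
    IsRainbow M (Function.update c k i) (Function.update e k f) := by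
  refine ⟨?_, ?_, ?_⟩
  · intro a b hab
    by_cases ha : a = k <;> by_cases hb : b = k
    · rw [ha, hb]
    · subst ha
      simp only [Function.update_self, Function.update_of_ne hb] at hab
      exact absurd hab.symm (hi b)
    · subst hb
      simp only [Function.update_self, Function.update_of_ne ha] at hab
      exact absurd hab (hi a)
    · simp only [Function.update_of_ne ha, Function.update_of_ne hb] at hab
      exact h.1 hab
  · intro j
    by_cases hj : j = k
    · subst hj
      simpa using hf
    · simpa [Function.update_of_ne hj] using h.2.1 j
  · intro a b hab
    by_cases ha : a = k
    · subst ha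
      rw [Function.update_self, Function.update_of_ne hab.symm]
      exact hdis b hab.symm
    · by_cases hb : b = k
      · subst hb
        rw [Function.update_self, Function.update_of_ne hab]
        exact (hdis a hab).symm
      · rw [Function.update_of_ne ha, Function.update_of_ne hb]
        exact h.2.2 a b hab

open Finset

variable [DecidableEq V]

/-- The edges of colour `i` that meet the vertex set of `e` in a single vertex, lying in `e k`. -/
def privateEdges (M : Fin n → Finset (Finset V)) (e : Fin m → Finset V) (i : Fin n)
    (k : Fin m) : Finset (Finset V) :=
  {f ∈ M i | #(f ∩ univ.biUnion e) = 1 ∧ ¬ Disjoint f (e k)}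

theorem disjoint_of_mem_privateEdges (h : IsRainbow M c e) {i : Fin n} {k l : Fin m}
    {f : Finset V} (hf : f ∈ privateEdges M e i k) (hlk : l ≠ k) : Disjoint f (e l) := by
  rw [privateEdges, mem_filter, not_disjoint_iff, card_eq_one] at hf
  obtain ⟨-, ⟨z, hz⟩, x, hxf, hxk⟩ := hf
  refine disjoint_left.2 fun y hyf hyl => ?_
  have eq_z : ∀ w j, w ∈ f → w ∈ e j → w = z := fun w j hwf hwj =>
    mem_singleton.1 (hz ▸ mem_inter.2 ⟨hwf, mem_biUnion.2 ⟨j, mem_univ j, hwj⟩⟩)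
  rw [eq_z y l hyf hyl] at hyl
  rw [eq_z x k hxf hxk] at hxk
  exact disjoint_left.1 (h.2.2 l k hlk) hyl hxk

/-- In a rainbow matching that cannot be enlarged, private edges at the same edge and of distinct
unused colours intersect. -/
theorem not_disjoint_privateEdges (h : IsRainbow M c e) (hmax : ¬ HasRainbow M (m + 1))
    {i j : Fin n} (hi : ∀ l, c l ≠ i) (hj : ∀ l, c l ≠ j) (hij : i ≠ j) {k : Fin m}
    {f g : Finset V} (hf : f ∈ privateEdges M e i k) (hg : g ∈ privateEdges M e j k) :
    ¬ Disjoint f g := by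
  intro hdis
  refine hmax (extend (h.update (k := k) hi (mem_filter.1 hf).1 fun l hl =>
    h.disjoint_of_mem_privateEdges hf hl) (i := j) (f := g) (fun l => ?_) (mem_filter.1 hg).1
      fun l => ?_)
  · by_cases hl : l = k
    · subst hl
      simpa using hij
    · simpa [Function.update_of_ne hl] using hj l
  · by_cases hl : l = k
    · subst hl
      simpa using hdis.symm
    · simpa [Function.update_of_ne hl] using h.disjoint_of_mem_privateEdges hg hl

theorem card_privateEdges_le (h : IsRainbow M c e) (hM : ∀ i, IsMatching r (M i)) (i : Fin n)
    (k : Fin m) : #(privateEdges M e i k) ≤ r := by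
  have hmatch : IsMatching r (privateEdges M e i k) :=
    ⟨fun f hf => (hM i).1 f (mem_filter.1 hf).1,
      fun f hf g hg => (hM i).2 f (mem_filter.1 hf).1 g (mem_filter.1 hg).1⟩
  calc #(privateEdges M e i k) = ∑ f ∈ privateEdges M e i k, 1 := card_eq_sum_ones _
    _ ≤ ∑ f ∈ privateEdges M e i k, #(f ∩ e k) := by
        refine sum_le_sum fun f hf => card_pos.2 ?_
        rw [← not_disjoint_iff_nonempty_inter]
        exact (mem_filter.1 hf).2.2
    _ ≤ #(e k) := hmatch.sum_card_inter_le _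
    _ = r := (hM _).1 _ (h.2.1 k)

/-- In a rainbow matching that cannot be enlarged, every unused colour has many private edges. -/
theorem le_sum_card_privateEdges (h : IsRainbow M c e) (hmax : ¬ HasRainbow M (m + 1))
    (hM : ∀ i, IsMatching r (M i)) {i : Fin n} (hi : ∀ l, c l ≠ i) :
    2 * #(M i) ≤ r * m + ∑ k, #(privateEdges M e i k) := by
  set U := univ.biUnion e with hU
  have hUcard : #U ≤ r * m := by
    refine card_biUnion_le.trans ?_
    rw [sum_congr rfl fun k _ => (hM _).1 _ (h.2.1 k)]
    simp [mul_comm]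
  have hmeet : ∀ f ∈ M i, 0 < #(f ∩ U) := by
    intro f hf
    by_contra hzero
    refine hmax (h.extend hi hf fun j => disjoint_left.2 fun x hxf hxj => hzero ?_)
    exact card_pos.2 ⟨x, mem_inter.2 ⟨hxf, mem_biUnion.2 ⟨j, mem_univ j, hxj⟩⟩⟩
  have hsingle : #{f ∈ M i | #(f ∩ U) = 1} ≤ ∑ k, #(privateEdges M e i k) := by
    refine le_trans (card_le_card fun f hf => ?_) card_biUnion_le
    rw [mem_filter] at hf
    obtain ⟨x, hx⟩ := card_pos.1 (hmeet f hf.1)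
    obtain ⟨k, -, hxk⟩ := mem_biUnion.1 (mem_inter.1 hx).2
    exact mem_biUnion.2 ⟨k, mem_univ k, mem_filter.2
      ⟨hf.1, hf.2, not_disjoint_iff.2 ⟨x, (mem_inter.1 hx).1, hxk⟩⟩⟩
  have hcount : 2 * #(M i) ≤ ∑ f ∈ M i, #(f ∩ U) + #{f ∈ M i | #(f ∩ U) = 1} := by
    rw [card_filter, ← sum_add_distrib, mul_comm, ← smul_eq_mul, ← sum_const]
    refine sum_le_sum fun f hf => ?_
    have := hmeet f hf
    split_ifs <;> omega
  have := (hM i).sum_card_inter_le U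
  omega

/-- In a rainbow matching that cannot be enlarged, only few unused colours have more than one
private edge at a given edge. -/
theorem two_mul_card_colours_le (h : IsRainbow M c e) (hmax : ¬ HasRainbow M (m + 1))
    (hM : ∀ i, IsMatching r (M i)) (hr : 0 < r) (k : Fin m) :
    2 * #{i ∈ univ \ univ.image c | 1 < #(privateEdges M e i k)} ≤ (2 * r).choose r := by
  have unused : ∀ i ∈ {i ∈ univ \ univ.image c | 1 < #(privateEdges M e i k)}, ∀ l, c l ≠ i := by
    intro i hi l hl
    simp only [mem_filter, mem_sdiff, mem_image, mem_univ, true_and] at hi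
    exact hi.1 ⟨l, hl⟩
  have pair : ∀ i, ∃ f g : Finset V, 1 < #(privateEdges M e i k) →
      f ∈ privateEdges M e i k ∧ g ∈ privateEdges M e i k ∧ f ≠ g := by
    intro i
    by_cases hi : 1 < #(privateEdges M e i k)
    · obtain ⟨f, hf, g, hg, hfg⟩ := one_lt_card.1 hi
      exact ⟨f, g, fun _ => ⟨hf, hg, hfg⟩⟩
    · exact ⟨∅, ∅, fun hi' => absurd hi' hi⟩
  choose f g hfg using pair
  have hmem : ∀ i, 1 < #(privateEdges M e i k) → ∀ s ∈ ({f i, g i} : Set (Finset V)),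
      s ∈ privateEdges M e i k := by
    rintro i hi s (rfl | rfl)
    · exact (hfg i hi).1
    · exact (hfg i hi).2.1
  refine two_mul_card_le_choose hr _ f g (fun i hi => ?_) (fun i hi => ?_) (fun i hi => ?_) ?_
  · exact (hM i).1 _ (mem_filter.1 (hfg i (mem_filter.1 hi).2).1).1
  · exact (hM i).1 _ (mem_filter.1 (hfg i (mem_filter.1 hi).2).2.1).1
  · obtain ⟨hf, hg, hne⟩ := hfg i (mem_filter.1 hi).2
    exact (hM i).2 _ (mem_filter.1 hf).1 _ (mem_filter.1 hg).1 hne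
  · intro i hi j hj hij s hs t ht
    exact h.not_disjoint_privateEdges hmax (unused i hi) (unused j hj) hij
      (hmem i (mem_filter.1 hi).2 s hs) (hmem j (mem_filter.1 hj).2 t ht)

end IsRainbow

open Finset in
/-- A rainbow matching that is too small can be replaced by a larger one. -/
theorem HasRainbow.succ {V : Type*} {n m r : ℕ} {M : Fin n → Finset (Finset V)} (hr : 0 < r)
    (hM : ∀ i, IsMatching r (M i) ∧ #(M i) = n) (h : HasRainbow M m)
    (hm : (r + 1) * m + (2 * r).choose r < 2 * n) : HasRainbow M (m + 1) := by
  classical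
  obtain ⟨c, e, hce⟩ := h
  change IsRainbow M c e at hce
  by_contra hmax
  have hmatch := fun i => (hM i).1
  set C := (2 * r).choose r
  set S : Finset (Fin n) := univ \ univ.image c
  have hS : #S + m = n := by
    have hle : m ≤ n := by simpa using Fintype.card_le_of_injective c hce.1
    have himage : #(univ.image c) = m := by simp [card_image_of_injective _ hce.1]
    rw [card_sdiff_of_subset (subset_univ _), himage, card_univ, Fintype.card_fin]
    omega
  have lower : #S * (m + C + 1) ≤ ∑ i ∈ S, ∑ k, #(IsRainbow.privateEdges M e i k) := by
    rw [← smul_eq_mul, ← sum_const]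
    refine sum_le_sum fun i hi => ?_
    have hi' : ∀ l, c l ≠ i := fun l hl =>
      (mem_sdiff.1 hi).2 (mem_image.2 ⟨l, mem_univ l, hl⟩)
    have := hce.le_sum_card_privateEdges hmax hmatch hi'
    rw [(hM i).2] at this
    linarith
  have upper : ∀ k, 2 * ∑ i ∈ S, #(IsRainbow.privateEdges M e i k) ≤ 2 * #S + (r - 1) * C := by
    intro k
    have hsum : ∑ i ∈ S, #(IsRainbow.privateEdges M e i k) ≤
        #S + (r - 1) * #{i ∈ S | 1 < #(IsRainbow.privateEdges M e i k)} := by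
      rw [card_filter, mul_sum, card_eq_sum_ones, ← sum_add_distrib]
      refine sum_le_sum fun i _ => ?_
      have := hce.card_privateEdges_le hmatch i k
      split_ifs <;> omega
    have := Nat.mul_le_mul_left (r - 1) (hce.two_mul_card_colours_le hmax hmatch hr k)
    change (r - 1) * (2 * #{i ∈ S | 1 < #(IsRainbow.privateEdges M e i k)}) ≤ (r - 1) * C at this
    linarith
  have total : 2 * (#S * (m + C + 1)) ≤ m * (2 * #S + (r - 1) * C) := by
    calc 2 * (#S * (m + C + 1))
        ≤ 2 * ∑ i ∈ S, ∑ k, #(IsRainbow.privateEdges M e i k) := Nat.mul_le_mul_left 2 lower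
      _ = ∑ k, 2 * ∑ i ∈ S, #(IsRainbow.privateEdges M e i k) := by rw [sum_comm, mul_sum]
      _ ≤ ∑ _k : Fin m, (2 * #S + (r - 1) * C) := sum_le_sum fun k _ => upper k
      _ = m * (2 * #S + (r - 1) * C) := by simp
  obtain ⟨q, rfl⟩ : ∃ q, r = q + 1 := ⟨r - 1, by omega⟩
  rw [Nat.add_sub_cancel] at total
  have hlarge : q * m < 2 * #S := by nlinarith
  nlinarith [Nat.mul_le_mul_right C hlarge.le]

/-- Theorem 1.8 (lower bound on g'(r,n)): every collection of n matchings of size n in an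
r-uniform hypergraph has a rainbow matching of size m with (r+1)m ≥ 2n - C(2r,r). -/
theorem stmt0 {V : Type*} (r n : ℕ) (hr : 3 ≤ r) (hn : 1 ≤ n)
    (M : Fin n → Finset (Finset V))
    (hM : ∀ i, IsMatching r (M i) ∧ (M i).card = n) :
    ∃ m : ℕ, HasRainbow M m ∧
      ((r : ℤ) + 1) * m ≥ 2 * n - (Nat.choose (2 * r) r : ℤ) := by
  by_contra! hsmall
  have hall : ∀ m, HasRainbow M m := by
    intro m
    induction m with
    | zero => exact ⟨Fin.elim0, Fin.elim0, fun j => j.elim0, fun j => j.elim0, fun j => j.elim0⟩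
    | succ m ih =>
      refine ih.succ (by omega) hM ?_
      have := hsmall m ih
      zify
      linarith
  have := hsmall (2 * n) (hall _)
  push_cast at this
  nlinarith [Nat.cast_nonneg (α := ℤ) ((2 * r).choose r)]
end

section
/- For every integer r ≥ 3 and every integer n > 6^r, there exists an r-partite r-uniform hypergraph and a collection of n matchings in it, each of size n, such that every rainbow matching has size at most n − (1/(12r))·n^{(r−1)/r}; equivalently, g(r,n) ≤ n − (1/(12r))·n^{(r−1)/r}. -/
open Finset in
/-- The number of points that a permutation moves out of a set is subadditive under composition. -/
lemma card_image_mul_sdiff_le {α : Type*} [DecidableEq α] (g h : Equiv.Perm α) (X : Finset α) :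
    (X.image (g * h) \ X).card ≤ (X.image g \ X).card + (X.image h \ X).card := by
  have hsub : X.image (g * h) \ X ⊆ (X.image h \ X).image g ∪ (X.image g \ X) := by
    intro v hv
    simp only [mem_union, mem_sdiff, mem_image, Equiv.Perm.mul_apply] at hv ⊢
    obtain ⟨⟨u, hu, rfl⟩, hv⟩ := hv
    by_cases hX : h u ∈ X
    · exact Or.inr ⟨⟨_, hX, rfl⟩, hv⟩
    · exact Or.inl ⟨_, ⟨⟨u, hu, rfl⟩, hX⟩, rfl⟩
  calc _ ≤ _ := card_le_card hsub
    _ ≤ _ := card_union_le _ _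
    _ ≤ _ := by
      have := card_image_le (s := X.image h \ X) (f := g)
      omega

open Finset in
lemma card_image_inv_sdiff {α : Type*} [DecidableEq α] (g : Equiv.Perm α) (X : Finset α) :
    (X.image (g⁻¹ : Equiv.Perm α) \ X).card = (X.image g \ X).card := by
  have h : (X.image (g⁻¹ : Equiv.Perm α) \ X).image g = X \ X.image g := by
    rw [image_sdiff _ _ g.injective, image_image]
    simp [Function.comp_def]
  rw [← card_image_of_injective _ g.injective, h]
  exact card_sdiff_comm (card_image_of_injective _ g.injective).symm

open Finset in
/-- If `X` is almost invariant under `x ↦ x + 1` and under a doubling map `μ`, then it is almost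
invariant under every translation. -/
lemma card_image_add_sdiff_le {N : ℕ} (X : Finset (ZMod N)) (μ : Equiv.Perm (ZMod N))
    (hμ : ∀ x, μ x = 2 * x) {d : ℕ}
    (h₁ : (X.image (Equiv.addRight (1 : ZMod N)) \ X).card ≤ d)
    (h₂ : (X.image μ \ X).card ≤ d) (k a : ℕ) (ha : a < 2 ^ k) :
    (X.image (Equiv.addRight (a : ZMod N)) \ X).card ≤ 3 * d * k := by
  induction k generalizing a with
  | zero =>
    obtain rfl : a = 0 := by simpa using ha
    simp
  | succ k ih =>
    have hhalf := ih (a / 2) (by rw [pow_succ] at ha; omega)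
    have hconj : (X.image (μ * (Equiv.addRight ((a / 2 : ℕ) : ZMod N) * μ⁻¹) :
        Equiv.Perm (ZMod N)) \ X).card ≤ 3 * d * k + 2 * d := by
      have e₁ := card_image_mul_sdiff_le μ (Equiv.addRight ((a / 2 : ℕ) : ZMod N) * μ⁻¹) X
      have e₂ := card_image_mul_sdiff_le (Equiv.addRight ((a / 2 : ℕ) : ZMod N)) μ⁻¹ X
      rw [card_image_inv_sdiff] at e₂
      omega
    have happ : ∀ x, (μ * (Equiv.addRight ((a / 2 : ℕ) : ZMod N) * μ⁻¹) :
        Equiv.Perm (ZMod N)) x = x + ((2 * (a / 2) : ℕ) : ZMod N) := by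
      intro x
      have hx : 2 * (μ⁻¹ : Equiv.Perm (ZMod N)) x = x := by rw [← hμ]; simp
      simp only [Equiv.Perm.mul_apply, Equiv.coe_addRight, hμ, mul_add, hx]
      push_cast
      rfl
    rcases Nat.mod_two_eq_zero_or_one a with h | h
    · have heq : (μ * (Equiv.addRight ((a / 2 : ℕ) : ZMod N) * μ⁻¹) : Equiv.Perm (ZMod N)) =
          Equiv.addRight (a : ZMod N) := by
        ext1 x
        rw [happ, Equiv.coe_addRight, show 2 * (a / 2) = a by omega]
      rw [heq] at hconj
      linarith
    · have heq : Equiv.addRight (1 : ZMod N) *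
          (μ * (Equiv.addRight ((a / 2 : ℕ) : ZMod N) * μ⁻¹) : Equiv.Perm (ZMod N)) =
          Equiv.addRight (a : ZMod N) := by
        ext1 x
        rw [Equiv.Perm.mul_apply, happ]
        simp only [Equiv.coe_addRight]
        rw [add_assoc]
        congr 1
        exact_mod_cast congrArg (Nat.cast (R := ZMod N)) (show 2 * (a / 2) + 1 = a by omega)
      have e := card_image_mul_sdiff_le (Equiv.addRight (1 : ZMod N))
        (μ * (Equiv.addRight ((a / 2 : ℕ) : ZMod N) * μ⁻¹)) X
      rw [heq] at e
      linarith

open Finset in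
lemma sum_card_image_add_sdiff {G : Type*} [AddGroup G] [Fintype G] [DecidableEq G]
    (X : Finset G) :
    ∑ a : G, (X.image (Equiv.addRight a) \ X).card = X.card * (Fintype.card G - X.card) := by
  have h : ∀ a : G, (X.image (Equiv.addRight a) \ X).card =
      ∑ u ∈ X, if u + a ∈ Xᶜ then 1 else 0 := by
    intro a
    rw [← card_filter,
      ← card_image_of_injective (X.filter fun u => u + a ∈ Xᶜ) (Equiv.addRight a).injective]
    congr 1
    ext v
    simp only [mem_sdiff, mem_image, mem_filter, mem_compl, Equiv.coe_addRight]
    constructor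
    · rintro ⟨⟨u, hu, rfl⟩, hv⟩
      exact ⟨u, ⟨hu, hv⟩, rfl⟩
    · rintro ⟨u, ⟨hu, hv⟩, rfl⟩
      exact ⟨⟨u, hu, rfl⟩, hv⟩
  simp_rw [h]
  rw [sum_comm, ← card_compl, ← smul_eq_mul, ← sum_const]
  refine sum_congr rfl fun u _ => ?_
  refine (Equiv.sum_comp (Equiv.addLeft u) (fun v => if v ∈ Xᶜ then 1 else 0)).trans ?_
  rw [← card_filter, filter_univ_mem]

open Finset in
/-- Expansion of the graph on `ZMod N` generated by `x ↦ x + 1` and `x ↦ 2 * x`. -/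
lemma card_mul_card_compl_le {N : ℕ} [NeZero N] (X : Finset (ZMod N)) (μ : Equiv.Perm (ZMod N))
    (hμ : ∀ x, μ x = 2 * x) {d k : ℕ}
    (h₁ : (X.image (Equiv.addRight (1 : ZMod N)) \ X).card ≤ d)
    (h₂ : (X.image μ \ X).card ≤ d) (hk : N < 2 ^ k) :
    X.card * (N - X.card) ≤ N * (3 * d * k) := by
  have h := sum_card_image_add_sdiff X
  rw [ZMod.card] at h
  rw [← h]
  calc _ ≤ ∑ _a : ZMod N, 3 * d * k := by
        refine sum_le_sum fun a _ => ?_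
        have := card_image_add_sdiff_le X μ hμ h₁ h₂ k a.val ((ZMod.val_lt a).trans hk)
        rwa [ZMod.natCast_zmod_val] at this
    _ = _ := by simp

open Finset in
/-- The edge with vertex `π k x` in part `k`. -/
def permEdge {r : ℕ} {ι : Type*} [DecidableEq ι] (π : Fin r → Equiv.Perm ι) (x : ι) :
    Finset (Fin r × ι) :=
  univ.image fun k => (k, π k x)

open Finset in
/-- The perfect matching consisting of the edges `permEdge π x`. -/
def permMatching {r : ℕ} {ι : Type*} [DecidableEq ι] [Fintype ι] (π : Fin r → Equiv.Perm ι) :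
    Finset (Finset (Fin r × ι)) :=
  univ.image (permEdge π)

section

open Finset

variable {r : ℕ} {ι : Type*} [DecidableEq ι]

lemma mem_permEdge {π : Fin r → Equiv.Perm ι} {x : ι} {p : Fin r × ι} :
    p ∈ permEdge π x ↔ π p.1 x = p.2 := by
  simp [permEdge, Prod.ext_iff]

lemma disjoint_permEdge {π ρ : Fin r → Equiv.Perm ι} {x y : ι} :
    Disjoint (permEdge π x) (permEdge ρ y) ↔ ∀ k, π k x ≠ ρ k y := by
  simp only [disjoint_left, mem_permEdge, Prod.forall]
  constructor
  · intro h k hk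
    exact h k _ rfl hk.symm
  · rintro h k _ rfl hk
    exact h k hk.symm

lemma isPartiteEdge_permEdge (π : Fin r → Equiv.Perm ι) (x : ι) :
    IsPartiteEdge r Prod.fst (permEdge π x) := by
  intro k
  rw [card_eq_one]
  refine ⟨(k, π k x), ?_⟩
  ext p
  simp only [mem_filter, mem_permEdge, mem_singleton, Prod.ext_iff]
  constructor
  · rintro ⟨h, rfl⟩
    exact ⟨rfl, h.symm⟩
  · rintro ⟨rfl, h⟩
    exact ⟨h.symm, rfl⟩

lemma permEdge_injective [NeZero r] (π : Fin r → Equiv.Perm ι) :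
    Function.Injective (permEdge π) := by
  intro x y h
  have : ((0 : Fin r), π 0 x) ∈ permEdge π y := h ▸ mem_permEdge.2 rfl
  exact ((π 0).injective (mem_permEdge.1 this)).symm

lemma isMatching_permMatching [Fintype ι] (π : Fin r → Equiv.Perm ι) :
    IsMatching r (permMatching π) := by
  constructor
  · intro e he
    obtain ⟨x, -, rfl⟩ := mem_image.1 he
    rw [permEdge, card_image_of_injective _ fun k l h => congrArg Prod.fst h]
    simp
  · intro e he f hf hne
    obtain ⟨x, -, rfl⟩ := mem_image.1 he
    obtain ⟨y, -, rfl⟩ := mem_image.1 hf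
    rw [disjoint_permEdge]
    intro k hk
    exact hne (congrArg _ ((π k).injective hk))

lemma card_permMatching [NeZero r] [Fintype ι] (π : Fin r → Equiv.Perm ι) :
    (permMatching π).card = Fintype.card ι := by
  rw [permMatching, card_image_of_injective _ (permEdge_injective π), card_univ]

/-- A rainbow matching of size `s` for `m` copies of the matching of `π` and `n - m` copies of the
identity matching yields a set that no `π k` moves much. -/
lemma exists_almost_invariant_of_hasRainbow [NeZero r] [Fintype ι] (π : Fin r → Equiv.Perm ι)
    (hπ : π 0 = 1) {n m s : ℕ} (hι : Fintype.card ι = n) (hm : m ≤ n)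
    (h : HasRainbow (fun i : Fin n => if (i : ℕ) < m then permMatching π
      else permMatching (1 : Fin r → Equiv.Perm ι)) s) :
    ∃ X : Finset ι, X.card ≤ m ∧ s ≤ X.card + (n - m) ∧ s ≤ n ∧
      ∀ k, (X.image (π k) \ X).card ≤ n - s := by
  obtain ⟨c, e, hc, he, hd⟩ := h
  have hx : ∀ j, ∃ x, e j = permEdge (if (c j : ℕ) < m then π else 1) x := by
    intro j
    have := he j
    dsimp only at this
    split_ifs at this ⊢ <;> (obtain ⟨x, -, hx⟩ := mem_image.1 this; exact ⟨x, hx.symm⟩)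
  choose x hx using hx
  have hdis : ∀ j l, j ≠ l → ∀ k, (if (c j : ℕ) < m then π else 1) k (x j) ≠
      (if (c l : ℕ) < m then π else 1) k (x l) := by
    intro j l hjl
    have := hd j l hjl
    rwa [hx, hx, disjoint_permEdge] at this
  have hx_inj : Function.Injective x := by
    intro j l hjl
    by_contra hne
    refine hdis j l hne 0 ?_
    have : ∀ j, (if (c j : ℕ) < m then π else 1) 0 = 1 := by
      intro j
      split_ifs
      · exact hπ
      · rfl
    rw [this, this, hjl]
  set S : Finset (Fin s) := univ.filter fun j => (c j : ℕ) < m with hS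
  have hcard : (S.image x).card + (Sᶜ.image x).card = s := by
    rw [card_image_of_injective _ hx_inj, card_image_of_injective _ hx_inj, card_add_card_compl]
    simp
  have hSm : S.card ≤ m := by
    calc S.card = (S.image fun j => (c j : ℕ)).card :=
          (card_image_of_injective _ (Fin.val_injective.comp hc)).symm
      _ ≤ (range m).card := card_le_card (by
          intro v hv
          obtain ⟨j, hj, rfl⟩ := mem_image.1 hv
          simpa [hS] using hj)
      _ = m := card_range m
  have hSc : Sᶜ.card ≤ n - m := by
    calc Sᶜ.card = (Sᶜ.image fun j => (c j : ℕ)).card :=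
          (card_image_of_injective _ (Fin.val_injective.comp hc)).symm
      _ ≤ (Ico m n).card := card_le_card (by
          intro v hv
          obtain ⟨j, hj, rfl⟩ := mem_image.1 hv
          simpa [hS] using hj)
      _ = n - m := Nat.card_Ico m n
  rw [← card_image_of_injective _ hx_inj] at hSm hSc
  refine ⟨S.image x, hSm, by omega, by omega, fun k => ?_⟩
  have hsub : (S.image x).image (π k) \ S.image x ⊆ (S.image x ∪ Sᶜ.image x)ᶜ := by
    intro v hv
    simp only [mem_sdiff, mem_compl, mem_union] at hv ⊢
    refine fun h => h.elim hv.2 fun h => ?_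
    obtain ⟨l, hl, rfl⟩ := mem_image.1 h
    obtain ⟨u, hu, hul⟩ := mem_image.1 hv.1
    obtain ⟨j, hj, rfl⟩ := mem_image.1 hu
    have hj' : (c j : ℕ) < m := by simpa [hS] using hj
    have hl' : ¬ (c l : ℕ) < m := by simpa [hS] using hl
    have := hdis j l (by rintro rfl; exact hl' hj') k
    rw [if_pos hj', if_neg hl'] at this
    exact this hul
  have hdisj : Disjoint (S.image x) (Sᶜ.image x) :=
    (disjoint_image hx_inj).2 disjoint_compl_right
  refine (card_le_card hsub).trans ?_
  rw [card_compl, card_union_of_disjoint hdisj, hcard, hι]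

end

open Finset in
lemma card_image_toLeft_sdiff_le {α β : Type*} [DecidableEq α] [DecidableEq β]
    (g : Equiv.Perm α) (X : Finset (α ⊕ β)) :
    (X.toLeft.image g \ X.toLeft).card ≤
      (X.image (Equiv.sumCongr g (1 : Equiv.Perm β)) \ X).card := by
  rw [← card_image_of_injective _ (Sum.inl_injective (α := α) (β := β))]
  refine card_le_card fun v hv => ?_
  simp only [mem_image, mem_sdiff, mem_toLeft] at hv ⊢
  obtain ⟨_, ⟨⟨u, hu, rfl⟩, hv⟩, rfl⟩ := hv
  exact ⟨⟨_, hu, rfl⟩, hv⟩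

/-- Numerical form of the expansion bound for a set of about half the points. -/
lemma le_of_expansion {r n s N p k : ℕ} {y : ℝ} (hr : 3 ≤ r) (hn : 216 < n) (hy : 6 ≤ y)
    (hs : s ≤ n) (hNn : N ≤ n) (hN : n ≤ N + 1) (hp : p ≤ n / 2)
    (hps : s ≤ p + 1 + (n - n / 2)) (hk : (k : ℝ) ≤ 73 / 100 * (r * y))
    (h : p * (N - p) ≤ N * (3 * (n - s) * k)) :
    (s : ℝ) ≤ n - n / (12 * (r * y)) := by
  by_contra! hlt
  have hr' : (3 : ℝ) ≤ r := by exact_mod_cast hr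
  have hry : (18 : ℝ) ≤ r * y := by nlinarith
  have hd : ((n : ℝ) - s) * (12 * (r * y)) < n := by
    rw [← lt_div_iff₀ (by positivity)]
    linarith
  have hn' : (217 : ℝ) ≤ n := by exact_mod_cast hn
  have hs' : (s : ℝ) ≤ n := by exact_mod_cast hs
  have hN₁ : (N : ℝ) ≤ n := by exact_mod_cast hNn
  have hN₂ : (n : ℝ) ≤ N + 1 := by exact_mod_cast hN
  have hp₁ : (2 : ℝ) * p ≤ n := by
    have : 2 * p ≤ n := by omega
    exact_mod_cast this
  have hp₂ : (2 : ℝ) * s ≤ 2 * p + 2 + (n + 1) := by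
    have : 2 * s ≤ 2 * p + 2 + (n + 1) := by omega
    exact_mod_cast this
  have hpN : p ≤ N := by omega
  have hR : (p : ℝ) * (N - p) ≤ N * (3 * (n - s) * k) := by
    have := (Nat.cast_le (α := ℝ)).2 h
    push_cast [Nat.cast_sub hpN, Nat.cast_sub hs] at this
    exact this
  have hd₂ : ((n : ℝ) - s) * 216 ≤ n := by nlinarith
  have hkd : ((n : ℝ) - s) * k ≤ 73 / 1200 * n := by nlinarith
  have hpl : (48 / 100 : ℝ) * n ≤ p := by linarith
  have hNp : (49 / 100 : ℝ) * N ≤ N - p := by linarith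
  have hprod : (48 / 100 : ℝ) * n * (49 / 100 * N) ≤ p * (N - p) := by gcongr
  nlinarith [mul_le_mul_of_nonneg_left hkd (by linarith : (0 : ℝ) ≤ 3 * N),
    mul_pos (by linarith : (0 : ℝ) < n) (by linarith : (0 : ℝ) < N)]

lemma natLog_two_succ_le {r n : ℕ} {y : ℝ} (hr : 3 ≤ r) (hy : 6 ≤ y) (hyn : y ^ r = n) :
    ((Nat.log 2 n + 1 : ℕ) : ℝ) ≤ 73 / 100 * (r * y) := by
  have hr' : (3 : ℝ) ≤ r := by exact_mod_cast hr
  have hn : n ≠ 0 := by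
    rintro rfl
    have : 0 < y ^ r := by positivity
    simp [hyn] at this
  have h₁ : (2 : ℝ) ^ Nat.log 2 n ≤ y ^ r := by
    rw [hyn]
    exact_mod_cast Nat.pow_log_le_self 2 hn
  have h₂ := Real.log_le_log (by positivity) h₁
  rw [Real.log_pow, Real.log_pow] at h₂
  have h₃ := Real.log_le_sub_one_of_pos (by positivity : 0 < y / 2)
  rw [Real.log_div (by positivity) (by norm_num)] at h₃
  have l₁ := Real.log_two_gt_d9
  have l₂ := Real.log_two_lt_d9
  have h₄ : (r : ℝ) * Real.log y ≤ r * (y / 2 - 3 / 10) := by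
    gcongr
    linarith
  have h₅ : (Nat.log 2 n : ℝ) * (693 / 1000) ≤ Nat.log 2 n * Real.log 2 := by
    gcongr
    linarith
  push_cast
  nlinarith

/-- Theorem 1.9 (upper bound on g(r,n)): for r ≥ 3 and n > 6^r there are n matchings of
size n in an r-partite r-uniform hypergraph with no rainbow matching larger than
n - n^((r-1)/r)/(12r). -/
theorem stmt1 (r n : ℕ) (hr : 3 ≤ r) (hn : 6 ^ r < n) :
    ∃ (V : Type) (P : V → Fin r) (M : Fin n → Finset (Finset V)),
      (∀ i, IsMatching r (M i) ∧ (M i).card = n ∧ ∀ e ∈ M i, IsPartiteEdge r P e) ∧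
      ∀ s : ℕ, HasRainbow M s →
        (s : ℝ) ≤ (n : ℝ) - (1 / (12 * (r : ℝ))) * (n : ℝ) ^ (((r : ℝ) - 1) / (r : ℝ)) := by
  obtain ⟨y, hy, hyn, hpow⟩ : ∃ y : ℝ, 6 ≤ y ∧ y ^ r = n ∧
      (n : ℝ) ^ (((r : ℝ) - 1) / (r : ℝ)) = n / y := by
    have hr₀ : (r : ℝ) ≠ 0 := by positivity
    have hn₀ : (0 : ℝ) < n := by exact_mod_cast (Nat.zero_le _).trans_lt hn
    have hroot : ((n : ℝ) ^ (1 / (r : ℝ))) ^ r = n := by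
      rw [← Real.rpow_natCast, ← Real.rpow_mul hn₀.le, one_div_mul_cancel hr₀, Real.rpow_one]
    refine ⟨(n : ℝ) ^ (1 / (r : ℝ)), ?_, hroot, ?_⟩
    · refine le_of_pow_le_pow_left₀ (n := r) (by omega) (by positivity) ?_
      rw [hroot]
      exact_mod_cast hn.le
    · rw [sub_div, div_self hr₀, Real.rpow_sub hn₀, Real.rpow_one]
  have hn' : 216 < n := by
    have := Nat.pow_le_pow_right (show 0 < 6 by norm_num) hr
    omega
  have : NeZero r := ⟨by omega⟩
  obtain ⟨N, hNn, hnN, hodd⟩ : ∃ N, N ≤ n ∧ n ≤ N + 1 ∧ Odd N := by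
    rcases Nat.even_or_odd n with h | h
    · exact ⟨n - 1, by omega, by omega, Nat.Even.sub_odd (by omega) h odd_one⟩
    · exact ⟨n, le_rfl, by omega, h⟩
  have : NeZero N := ⟨by omega⟩
  obtain ⟨μ, hμ⟩ : ∃ μ : Equiv.Perm (ZMod N), ∀ x, μ x = 2 * x := by
    refine ⟨Units.mulLeft (ZMod.unitOfCoprime 2 hodd.coprime_two_left), fun x => ?_⟩
    simp
  set τ : Equiv.Perm (ZMod N ⊕ Fin (n - N)) :=
    Equiv.sumCongr (Equiv.addRight (1 : ZMod N)) (1 : Equiv.Perm (Fin (n - N)))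
  set ν : Equiv.Perm (ZMod N ⊕ Fin (n - N)) :=
    Equiv.sumCongr μ (1 : Equiv.Perm (Fin (n - N)))
  set π : Fin r → Equiv.Perm (ZMod N ⊕ Fin (n - N)) := fun k =>
    if (k : ℕ) = 1 then τ else if (k : ℕ) = 2 then ν else 1 with hπ
  have hcard : Fintype.card (ZMod N ⊕ Fin (n - N)) = n := by
    rw [Fintype.card_sum, ZMod.card, Fintype.card_fin]
    omega
  refine ⟨Fin r × (ZMod N ⊕ Fin (n - N)), Prod.fst, fun i => if (i : ℕ) < n / 2 then
    permMatching π else permMatching 1, fun i => ?_, fun s h => ?_⟩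
  · have key : ∀ ρ : Fin r → Equiv.Perm (ZMod N ⊕ Fin (n - N)),
        IsMatching r (permMatching ρ) ∧ (permMatching ρ).card = n ∧
          ∀ e ∈ permMatching ρ, IsPartiteEdge r Prod.fst e := by
      refine fun ρ => ⟨isMatching_permMatching ρ, (card_permMatching ρ).trans hcard, ?_⟩
      intro e he
      obtain ⟨x, -, rfl⟩ := Finset.mem_image.1 he
      exact isPartiteEdge_permEdge ρ x
    dsimp only
    split_ifs
    · exact key π
    · exact key 1
  · obtain ⟨X, hX, hsX, hs, hinv⟩ := exists_almost_invariant_of_hasRainbow π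
      (by simp [hπ]) hcard (Nat.div_le_self n 2) h
    have hleft : X.toLeft.card ≤ X.card ∧ X.card ≤ X.toLeft.card + 1 := by
      have h₁ := X.card_toLeft_add_card_toRight
      have h₂ := X.toRight.card_le_univ
      rw [Fintype.card_fin] at h₂
      omega
    have h₁ : (X.toLeft.image (Equiv.addRight (1 : ZMod N)) \ X.toLeft).card ≤ n - s := by
      refine (card_image_toLeft_sdiff_le _ X).trans ?_
      simpa [hπ] using hinv ⟨1, by omega⟩
    have h₂ : (X.toLeft.image μ \ X.toLeft).card ≤ n - s := by
      refine (card_image_toLeft_sdiff_le _ X).trans ?_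
      simpa [hπ] using hinv ⟨2, by omega⟩
    have hexp := card_mul_card_compl_le X.toLeft μ hμ h₁ h₂
      (hNn.trans_lt (Nat.lt_pow_succ_log_self one_lt_two n))
    have hfin := le_of_expansion hr hn' hy hs hNn hnN (hleft.1.trans hX) (by omega)
      (natLog_two_succ_le hr hy hyn) hexp
    rw [hpow]
    convert hfin using 2
    field_simp
end

section
/- Let r ≥ 2 be an integer and let H_1, …, H_n be a collection of n matchings, each of size N, in an r-uniform hypergraph. If m is the size of a maximum rainbow matching for this collection (i.e., there is a rainbow matching of size m and every rainbow matching has size at most m), then 2·(n − m)·(2N − (r+1)·m) ≤ (r−1)·binom(2r, r)·m. -/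
open Finset in
/-- The **Bollobás set pairs inequality**. -/
theorem sum_inv_choose_le_one_of_cross_intersecting {α ι : Type*} [DecidableEq α]
    (X : Finset α) (I : Finset ι) (A B : ι → Finset α)
    (hA : ∀ i ∈ I, A i ⊆ X) (hB : ∀ i ∈ I, B i ⊆ X)
    (hAB : ∀ i ∈ I, Disjoint (A i) (B i))
    (hcross : ∀ i ∈ I, ∀ k ∈ I, i ≠ k → ¬ Disjoint (A i) (B k)) :
    ∑ i ∈ I, (((#(A i) + #(B i)).choose #(A i) : ℕ) : ℚ)⁻¹ ≤ 1 := by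
  induction X using Finset.strongInduction generalizing I B with
  | H X ih =>
  by_cases hempty : ∃ i ∈ I, B i = ∅
  · obtain ⟨i, hi, hBi⟩ := hempty
    have hI : I = {i} := by
      refine eq_singleton_iff_unique_mem.2 ⟨hi, fun k hk => ?_⟩
      by_contra hki
      exact hcross k hk i hi hki (by simp [hBi])
    simp [hI, hBi]
  push Not at hempty
  rcases I.eq_empty_or_nonempty with rfl | ⟨i₀, hi₀⟩
  · simp
  have hXpos : (0 : ℚ) < #X := by
    exact_mod_cast card_pos.2 ((hempty i₀ hi₀).mono (hB i₀ hi₀))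
  have hstep : ∀ x ∈ X, ∑ i ∈ I, (if x ∈ A i then (0 : ℚ) else
      (((#(A i) + #((B i).erase x)).choose #(A i) : ℕ) : ℚ)⁻¹) ≤ 1 := by
    intro x hx
    have h := ih (X.erase x) (erase_ssubset hx) (I.filter fun i => x ∉ A i)
      (fun i => (B i).erase x)
      (fun i hi => subset_erase.2 ⟨hA i (mem_filter.1 hi).1, (mem_filter.1 hi).2⟩)
      (fun i hi => erase_subset_erase _ (hB i (mem_filter.1 hi).1))
      (fun i hi => (hAB i (mem_filter.1 hi).1).mono_right (erase_subset _ _))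
      (fun i hi k hk hik hd => hcross i (mem_filter.1 hi).1 k (mem_filter.1 hk).1 hik <| by
        rw [disjoint_left] at hd ⊢
        intro y hy hy'
        refine hd hy (mem_erase.2 ⟨?_, hy'⟩)
        rintro rfl
        exact (mem_filter.1 hi).2 hy)
    rw [sum_filter] at h
    simpa [ite_not] using h
  have hterm : ∀ i ∈ I, ∑ x ∈ X, (if x ∈ A i then (0 : ℚ) else
      (((#(A i) + #((B i).erase x)).choose #(A i) : ℕ) : ℚ)⁻¹) =
      #X * (((#(A i) + #(B i)).choose #(A i) : ℕ) : ℚ)⁻¹ := by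
    intro i hi
    obtain ⟨b, hb⟩ : ∃ b, #(B i) = b + 1 :=
      Nat.exists_eq_succ_of_ne_zero (card_ne_zero.2 (hempty i hi))
    have hunion : A i ∪ B i ⊆ X := union_subset (hA i hi) (hB i hi)
    rw [← sum_sdiff hunion, sum_union (hAB i hi)]
    have h1 : ∑ x ∈ X \ (A i ∪ B i), (if x ∈ A i then (0 : ℚ) else
        (((#(A i) + #((B i).erase x)).choose #(A i) : ℕ) : ℚ)⁻¹) =
        (#X - (#(A i) + #(B i))) * (((#(A i) + #(B i)).choose #(A i) : ℕ) : ℚ)⁻¹ := by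
      have hc : (#(X \ (A i ∪ B i)) : ℚ) = #X - (#(A i) + #(B i)) := by
        rw [cast_card_sdiff hunion, card_union_of_disjoint (hAB i hi)]
        push_cast
        ring
      rw [← hc, ← nsmul_eq_mul]
      refine sum_eq_card_nsmul fun x hx => ?_
      simp only [mem_sdiff, mem_union, not_or] at hx
      rw [if_neg hx.2.1, erase_eq_of_notMem hx.2.2]
    have h2 : ∑ x ∈ A i, (if x ∈ A i then (0 : ℚ) else
        (((#(A i) + #((B i).erase x)).choose #(A i) : ℕ) : ℚ)⁻¹) = 0 :=
      sum_eq_zero fun x hx => if_pos hx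
    have h3 : ∑ x ∈ B i, (if x ∈ A i then (0 : ℚ) else
        (((#(A i) + #((B i).erase x)).choose #(A i) : ℕ) : ℚ)⁻¹) =
        (b + 1) * (((#(A i) + b).choose #(A i) : ℕ) : ℚ)⁻¹ := by
      have hc : (#(B i) : ℚ) = b + 1 := by rw [hb]; push_cast; rfl
      rw [← hc, ← nsmul_eq_mul]
      refine sum_eq_card_nsmul fun x hx => ?_
      rw [if_neg (disjoint_right.1 (hAB i hi) hx), card_erase_of_mem hx, hb,
        Nat.add_sub_cancel]
    rw [h1, h2, h3, hb]
    have hchoose : ((#(A i) + (b + 1)).choose #(A i) : ℚ) * (b + 1) =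
        (#(A i) + b + 1) * ((#(A i) + b).choose #(A i) : ℚ) := by
      have h := Nat.choose_mul_succ_eq (#(A i) + b) #(A i)
      rw [show #(A i) + b + 1 - #(A i) = b + 1 by omega] at h
      have h' : (((#(A i) + b).choose #(A i) * (#(A i) + b + 1) : ℕ) : ℚ) =
        (((#(A i) + b + 1).choose #(A i) * (b + 1) : ℕ) : ℚ) := by rw [h]
      push_cast at h'
      rw [← add_assoc]
      linarith
    have p1 : ((#(A i) + (b + 1)).choose #(A i) : ℚ) ≠ 0 := by
      exact_mod_cast (Nat.choose_pos (Nat.le_add_right _ _)).ne'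
    have p2 : ((#(A i) + b).choose #(A i) : ℚ) ≠ 0 := by
      exact_mod_cast (Nat.choose_pos (Nat.le_add_right _ _)).ne'
    field_simp
    push_cast
    linear_combination hchoose
  have htotal : #X * ∑ i ∈ I, (((#(A i) + #(B i)).choose #(A i) : ℕ) : ℚ)⁻¹ ≤ (#X : ℚ) * 1 := by
    rw [mul_sum, ← sum_congr rfl hterm, sum_comm, mul_one]
    simpa using sum_le_sum hstep
  exact le_of_mul_le_mul_left htotal hXpos

open Finset in
/-- Pairs of disjoint `r`-sets such that sets from different pairs always meet. -/
theorem two_mul_card_le_choose_of_pairs {V ι : Type*} {r : ℕ} (hr : r ≠ 0) (T : Finset ι)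
    (f : ι → Bool → Finset V) (hcard : ∀ i ∈ T, ∀ a, #(f i a) = r)
    (hdisj : ∀ i ∈ T, Disjoint (f i true) (f i false))
    (hmeet : ∀ i ∈ T, ∀ k ∈ T, i ≠ k → ∀ a b, ¬ Disjoint (f i a) (f k b)) :
    2 * #T ≤ (2 * r).choose r := by
  classical
  have h := sum_inv_choose_le_one_of_cross_intersecting
    ((T ×ˢ (univ : Finset Bool)).biUnion fun p => f p.1 p.2) (T ×ˢ (univ : Finset Bool))
    (fun p => f p.1 p.2) (fun p => f p.1 (!p.2))
    (fun p hp => subset_biUnion_of_mem (fun p : ι × Bool => f p.1 p.2) hp)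
    (fun p hp => subset_biUnion_of_mem (fun p : ι × Bool => f p.1 p.2)
      (x := (p.1, !p.2)) (by simpa using hp))
    (by
      rintro ⟨i, a⟩ hp
      have hi : i ∈ T := by simpa using hp
      cases a
      · exact (hdisj i hi).symm
      · exact hdisj i hi)
    (by
      rintro ⟨i, a⟩ hp ⟨k, b⟩ hq hne
      have hi : i ∈ T := by simpa using hp
      have hk : k ∈ T := by simpa using hq
      by_cases hik : i = k
      · subst hik
        have hab : (!b) = a := by
          cases a <;> cases b <;> simp_all
        simp only [hab, disjoint_self_iff_empty, ← card_eq_zero, hcard i hi]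
        exact hr
      · exact hmeet i hi k hk hik _ _)
  have hconst : ∑ p ∈ T ×ˢ (univ : Finset Bool),
      (((#(f p.1 p.2) + #(f p.1 (!p.2))).choose #(f p.1 p.2) : ℕ) : ℚ)⁻¹ =
      (2 * #T : ℕ) * (((2 * r).choose r : ℕ) : ℚ)⁻¹ := by
    have hc : #(T ×ˢ (univ : Finset Bool)) = 2 * #T := by simp [mul_comm]
    rw [← hc, ← nsmul_eq_mul]
    refine sum_eq_card_nsmul fun p hp => ?_
    have hi : p.1 ∈ T := by simpa using hp
    rw [hcard _ hi, hcard _ hi, two_mul]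
  rw [hconst, ← div_eq_mul_inv, div_le_one₀
    (by exact_mod_cast Nat.choose_pos (by omega : r ≤ 2 * r))] at h
  exact_mod_cast h

/-- An edge of an unused colour meets every maximum rainbow matching. -/
theorem exists_not_disjoint_of_rainbow_max {V : Type*} {n m : ℕ} {H : Fin n → Finset (Finset V)}
    (hmax : ∀ s, HasRainbow H s → s ≤ m) {c : Fin m → Fin n} {e : Fin m → Finset V}
    (hc : Function.Injective c) (he : ∀ j, e j ∈ H (c j))
    (hd : ∀ j k, j ≠ k → Disjoint (e j) (e k)) {i : Fin n} (hi : ∀ j, c j ≠ i)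
    {f : Finset V} (hf : f ∈ H i) : ∃ j, ¬ Disjoint f (e j) := by
  by_contra! hcon
  refine absurd (hmax (m + 1) ⟨Fin.cons i c, Fin.cons f e, ?_, ?_, ?_⟩) (by omega)
  · exact Fin.cons_injective_iff.2 ⟨fun ⟨j, hj⟩ => hi j hj, hc⟩
  · intro j
    cases j using Fin.cases with
    | zero => simpa using hf
    | succ j => simpa using he j
  · intro j k hjk
    cases j using Fin.cases with
    | zero =>
      cases k using Fin.cases with
      | zero => exact absurd rfl hjk
      | succ k => simpa using hcon k
    | succ j =>
      cases k using Fin.cases with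
      | zero => simpa using (hcon j).symm
      | succ k => simpa using hd j k fun h => hjk (by rw [h])

/-- Two edges of distinct unused colours, both meeting only the edge `e j` of a maximum rainbow
matching, intersect. -/
theorem not_disjoint_of_rainbow_max {V : Type*} {n m : ℕ} {H : Fin n → Finset (Finset V)}
    (hmax : ∀ s, HasRainbow H s → s ≤ m) {c : Fin m → Fin n} {e : Fin m → Finset V}
    (hc : Function.Injective c) (he : ∀ j, e j ∈ H (c j))
    (hd : ∀ j k, j ≠ k → Disjoint (e j) (e k)) {i i' : Fin n} (hi : ∀ j, c j ≠ i)
    (hi' : ∀ j, c j ≠ i') (hii' : i ≠ i') {f g : Finset V} (hf : f ∈ H i) (hg : g ∈ H i')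
    {j : Fin m} (hfj : ∀ k, k ≠ j → Disjoint f (e k)) (hgj : ∀ k, k ≠ j → Disjoint g (e k)) :
    ¬ Disjoint f g := by
  obtain ⟨k, hk⟩ := exists_not_disjoint_of_rainbow_max hmax
    (c := Function.update c j i) (e := Function.update e j f) (i := i') (f := g)
    (by
      intro a b hab
      by_cases ha : a = j <;> by_cases hb : b = j
      · rw [ha, hb]
      · subst ha
        simp only [Function.update_self, Function.update_of_ne hb] at hab
        exact absurd hab.symm (hi b)
      · subst hb
        simp only [Function.update_self, Function.update_of_ne ha] at hab
        exact absurd hab (hi a)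
      · simp only [Function.update_of_ne ha, Function.update_of_ne hb] at hab
        exact hc hab)
    (by
      intro a
      by_cases ha : a = j
      · subst ha
        simpa using hf
      · simpa [Function.update_of_ne ha] using he a)
    (by
      intro a b hab
      by_cases ha : a = j <;> by_cases hb : b = j
      · exact absurd (ha.trans hb.symm) hab
      · subst ha
        simpa [Function.update_of_ne hb] using hfj b hb
      · subst hb
        simpa [Function.update_of_ne ha] using (hfj a ha).symm
      · simpa [Function.update_of_ne ha, Function.update_of_ne hb] using hd a b hab)
    (by
      intro a
      by_cases ha : a = j
      · subst ha
        simpa using hii'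
      · simpa [Function.update_of_ne ha] using hi' a)
    hg
  by_cases hkj : k = j
  · subst hkj
    rw [Function.update_self] at hk
    exact fun h => hk h.symm
  · rw [Function.update_of_ne hkj] at hk
    exact absurd (hgj k hkj) hk

open Classical in
/-- The edges of `A` that meet `e j` and no other edge of the family `e`. -/
noncomputable def lonelyEdges {V : Type*} {m : ℕ} (A : Finset (Finset V))
    (e : Fin m → Finset V) (j : Fin m) : Finset (Finset V) :=
  A.filter fun f => ¬ Disjoint f (e j) ∧ ∀ k, k ≠ j → Disjoint f (e k)

theorem mem_lonelyEdges {V : Type*} {m : ℕ} {A : Finset (Finset V)} {e : Fin m → Finset V}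
    {j : Fin m} {f : Finset V} : f ∈ lonelyEdges A e j ↔
      f ∈ A ∧ ¬ Disjoint f (e j) ∧ ∀ k, k ≠ j → Disjoint f (e k) := by
  classical
  simp [lonelyEdges]

open Finset in
theorem sum_card_inter_le_card {V : Type*} [DecidableEq V] {r : ℕ} {A : Finset (Finset V)}
    (hA : IsMatching r A) (s : Finset V) : ∑ f ∈ A, #(f ∩ s) ≤ #s := by
  rw [← card_biUnion]
  · exact card_le_card (biUnion_subset.2 fun f _ => inter_subset_right)
  · exact fun f hf g hg hfg =>
      (hA.2 f hf g hg hfg).mono inter_subset_left inter_subset_left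

open Finset in
theorem card_lonelyEdges_le {V : Type*} {r m : ℕ} {A : Finset (Finset V)}
    (hA : IsMatching r A) (e : Fin m → Finset V) (j : Fin m) :
    #(lonelyEdges A e j) ≤ #(e j) := by
  classical
  calc #(lonelyEdges A e j) = ∑ f ∈ lonelyEdges A e j, 1 := card_eq_sum_ones _
    _ ≤ ∑ f ∈ lonelyEdges A e j, #(f ∩ e j) := sum_le_sum fun f hf =>
        card_pos.2 (not_disjoint_iff_nonempty_inter.1 (mem_lonelyEdges.1 hf).2.1)
    _ ≤ ∑ f ∈ A, #(f ∩ e j) :=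
        sum_le_sum_of_subset fun f hf => (mem_lonelyEdges.1 hf).1
    _ ≤ #(e j) := sum_card_inter_le_card hA _

open Finset in
/-- If every edge of the matching `A` meets the family `e`, then many edges are lonely. -/
theorem two_mul_card_le_add_sum_lonelyEdges {V : Type*} {r m : ℕ} {A : Finset (Finset V)}
    (hA : IsMatching r A) (e : Fin m → Finset V) (he : ∀ j, #(e j) = r)
    (hmeet : ∀ f ∈ A, ∃ j, ¬ Disjoint f (e j)) :
    2 * #A ≤ r * m + ∑ j, #(lonelyEdges A e j) := by
  classical
  have hpoint : ∀ f ∈ A, 2 ≤ ∑ j, (#(f ∩ e j) + if f ∈ lonelyEdges A e j then 1 else 0) := by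
    intro f hf
    obtain ⟨j, hj⟩ := hmeet f hf
    have hj1 : 1 ≤ #(f ∩ e j) := card_pos.2 (not_disjoint_iff_nonempty_inter.1 hj)
    by_cases hl : ∀ k, k ≠ j → Disjoint f (e k)
    · refine le_trans ?_ (single_le_sum (fun _ _ => Nat.zero_le _) (mem_univ j))
      rw [if_pos (mem_lonelyEdges.2 ⟨hf, hj, hl⟩)]
      omega
    · push Not at hl
      obtain ⟨k, hkj, hk⟩ := hl
      have hk1 : 1 ≤ #(f ∩ e k) := card_pos.2 (not_disjoint_iff_nonempty_inter.1 hk)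
      refine le_trans ?_ (sum_le_sum_of_subset (subset_univ {k, j}))
      rw [sum_pair hkj]
      omega
  calc 2 * #A = ∑ f ∈ A, 2 := by simp [mul_comm]
    _ ≤ ∑ f ∈ A, ∑ j, (#(f ∩ e j) + if f ∈ lonelyEdges A e j then 1 else 0) :=
        sum_le_sum hpoint
    _ = ∑ j, ∑ f ∈ A, #(f ∩ e j) + ∑ j, #(lonelyEdges A e j) := by
        rw [sum_comm, ← sum_add_distrib]
        refine sum_congr rfl fun j _ => ?_
        rw [sum_add_distrib, ← sum_filter, card_eq_sum_ones, filter_mem_eq_inter,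
          inter_eq_right.2 fun f hf => (mem_lonelyEdges.1 hf).1]
    _ ≤ r * m + ∑ j, #(lonelyEdges A e j) := by
        gcongr
        calc ∑ j, ∑ f ∈ A, #(f ∩ e j) ≤ ∑ j : Fin m, r :=
              sum_le_sum fun j _ => (sum_card_inter_le_card hA _).trans (he j).le
          _ = r * m := by simp [mul_comm]

open Finset in
/-- At most half of `(2 * r).choose r` unused colours have two lonely edges at `e j`. -/
theorem two_mul_card_filter_lonelyEdges_le {V : Type*} {r n m : ℕ} (hr : r ≠ 0)
    {H : Fin n → Finset (Finset V)} (hH : ∀ i, IsMatching r (H i))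
    (hmax : ∀ s, HasRainbow H s → s ≤ m) {c : Fin m → Fin n} {e : Fin m → Finset V}
    (hc : Function.Injective c) (he : ∀ j, e j ∈ H (c j))
    (hd : ∀ j k, j ≠ k → Disjoint (e j) (e k)) (U : Finset (Fin n))
    (hU : ∀ i ∈ U, ∀ j, c j ≠ i) (j : Fin m) :
    2 * #(U.filter fun i => 1 < #(lonelyEdges (H i) e j)) ≤ (2 * r).choose r := by
  have hpair : ∀ i, ∃ p : Bool → Finset V, 1 < #(lonelyEdges (H i) e j) →
      (∀ a, p a ∈ lonelyEdges (H i) e j) ∧ p true ≠ p false := by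
    intro i
    by_cases h : 1 < #(lonelyEdges (H i) e j)
    · obtain ⟨f, hf, g, hg, hfg⟩ := one_lt_card.1 h
      exact ⟨fun a => cond a f g, fun _ => ⟨by rintro (_ | _) <;> assumption, hfg⟩⟩
    · exact ⟨fun _ => ∅, fun h' => absurd h' h⟩
  choose p hp using hpair
  refine two_mul_card_le_choose_of_pairs hr _ p ?_ ?_ ?_
  · intro i hi a
    exact (hH i).1 _ (mem_lonelyEdges.1 ((hp i (mem_filter.1 hi).2).1 a)).1
  · intro i hi
    have h := hp i (mem_filter.1 hi).2
    exact (hH i).2 _ (mem_lonelyEdges.1 (h.1 true)).1 _ (mem_lonelyEdges.1 (h.1 false)).1 h.2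
  · intro i hi k hk hik a b
    have h := mem_lonelyEdges.1 ((hp i (mem_filter.1 hi).2).1 a)
    have h' := mem_lonelyEdges.1 ((hp k (mem_filter.1 hk).2).1 b)
    exact not_disjoint_of_rainbow_max hmax hc he hd (hU i (mem_filter.1 hi).1)
      (hU k (mem_filter.1 hk).1) hik h.1 h'.1 h.2.2 h'.2.2

/-- Lemma 2.1: if m is the maximum size of a rainbow matching for n matchings of size N
in an r-uniform hypergraph, then 2(n-m)(2N-(r+1)m) ≤ (r-1)·C(2r,r)·m. -/
theorem stmt2 {V : Type*} (r n N m : ℕ) (hr : 2 ≤ r)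
    (H : Fin n → Finset (Finset V))
    (hH : ∀ i, IsMatching r (H i) ∧ (H i).card = N)
    (hm : HasRainbow H m) (hmax : ∀ s, HasRainbow H s → s ≤ m) :
    2 * ((n : ℤ) - m) * (2 * N - (r + 1) * m) ≤
      ((r : ℤ) - 1) * (Nat.choose (2 * r) r : ℤ) * m := by
  classical
  obtain ⟨c, e, hc, he, hd⟩ := hm
  have hr0 : r ≠ 0 := by omega
  have hecard : ∀ j, (e j).card = r := fun j => (hH (c j)).1.1 _ (he j)
  set U : Finset (Fin n) := Finset.univ \ Finset.univ.image c with hU_def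
  have hU : ∀ i ∈ U, ∀ j, c j ≠ i := by
    intro i hi j hj
    simp only [hU_def, Finset.mem_sdiff, Finset.mem_image, Finset.mem_univ, true_and] at hi
    exact hi ⟨j, hj⟩
  have hUcard : (U.card : ℤ) = n - m := by
    rw [hU_def, Finset.cast_card_sdiff (Finset.subset_univ _),
      Finset.card_image_of_injective _ hc]
    simp
  have hlower : ∀ i ∈ U, (2 * N - (r + 1) * m : ℤ) ≤
      ∑ j, (((lonelyEdges (H i) e j).card : ℤ) - 1) := by
    intro i hi
    have h := two_mul_card_le_add_sum_lonelyEdges (hH i).1 e hecard fun f hf =>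
      exists_not_disjoint_of_rainbow_max hmax hc he hd (hU i hi) hf
    rw [(hH i).2] at h
    zify at h
    simp only [Finset.sum_sub_distrib, Finset.sum_const, Finset.card_univ, Fintype.card_fin,
      nsmul_eq_mul, mul_one]
    linarith
  have hupper : ∀ j, 2 * ∑ i ∈ U, (((lonelyEdges (H i) e j).card : ℤ) - 1) ≤
      ((r : ℤ) - 1) * (Nat.choose (2 * r) r : ℤ) := by
    intro j
    have hr1 : (0 : ℤ) ≤ (r : ℤ) - 1 := by omega
    have hcount : (2 * ((U.filter fun i => 1 < (lonelyEdges (H i) e j).card).card : ℤ)) ≤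
        (Nat.choose (2 * r) r : ℤ) := by
      exact_mod_cast two_mul_card_filter_lonelyEdges_le hr0 (fun i => (hH i).1)
        hmax hc he hd U hU j
    have hsum : ∑ i ∈ U, (((lonelyEdges (H i) e j).card : ℤ) - 1) ≤
        ((U.filter fun i => 1 < (lonelyEdges (H i) e j).card).card : ℤ) * ((r : ℤ) - 1) := by
      rw [← nsmul_eq_mul, ← Finset.sum_const, Finset.sum_filter]
      refine Finset.sum_le_sum fun i _ => ?_
      have hle := card_lonelyEdges_le (hH i).1 e j
      rw [hecard j] at hle
      split_ifs <;> omega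
    nlinarith [mul_le_mul_of_nonneg_left hcount hr1]
  calc 2 * ((n : ℤ) - m) * (2 * N - (r + 1) * m)
      = 2 * ∑ i ∈ U, (2 * N - (r + 1) * m : ℤ) := by
        rw [Finset.sum_const, nsmul_eq_mul, hUcard, mul_assoc]
    _ ≤ 2 * ∑ i ∈ U, ∑ j, (((lonelyEdges (H i) e j).card : ℤ) - 1) := by
        gcongr with i hi
        exact hlower i hi
    _ = ∑ j, 2 * ∑ i ∈ U, (((lonelyEdges (H i) e j).card : ℤ) - 1) := by
        rw [Finset.sum_comm, Finset.mul_sum]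
    _ ≤ ∑ _j : Fin m, ((r : ℤ) - 1) * (Nat.choose (2 * r) r : ℤ) :=
        Finset.sum_le_sum fun j _ => hupper j
    _ = ((r : ℤ) - 1) * (Nat.choose (2 * r) r : ℤ) * m := by
        simp [mul_comm]
end

section
/- Let r ≥ 2 be an integer, let H_1, …, H_n be matchings, each of size N, in an r-uniform hypergraph, and let M be a rainbow matching of maximum size m for this collection, using a set C ⊆ {1,…,n} of m colours (one edge of M from H_c for each c ∈ C). For an index i ∉ C, call an edge e ∈ M good for i if there exist two distinct edges f_1, f_2 ∈ H_i with f_1 ∩ V(M) ⊆ e and f_2 ∩ V(M) ⊆ e, where V(M) is the set of vertices covered by M. Then every edge e ∈ M is good for at most (1/2)·binom(2r, r) indices i ∉ C; that is, 2·|{i ∉ C : e is good for i}| ≤ binom(2r, r). -/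
/-- Bollobás's set-pairs inequality: if `A i` and `B i` are disjoint while `A i` meets `B j`
whenever `i ≠ j`, then the reciprocals of `(|A i| + |B i|).choose |A i|` sum to at most one. -/
theorem sum_inv_choose_card_le_one {ι α : Type*} (s : Finset ι) (A B : ι → Finset α)
    (hdisj : ∀ i ∈ s, Disjoint (A i) (B i))
    (hcross : ∀ i ∈ s, ∀ j ∈ s, i ≠ j → ¬ Disjoint (A i) (B j)) :
    ∑ i ∈ s, (((A i).card + (B i).card).choose (A i).card : ℚ)⁻¹ ≤ 1 := by
  classical
  obtain ⟨X, hX⟩ : ∃ X : Finset α, ∀ i ∈ s, A i ∪ B i ⊆ X :=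
    ⟨s.biUnion fun i => A i ∪ B i, fun i hi =>
      Finset.subset_biUnion_of_mem (fun i => A i ∪ B i) hi⟩
  induction X using Finset.strongInduction generalizing s B with
  | H X ih =>
  by_cases hB : ∃ i ∈ s, B i = ∅
  · obtain ⟨i, hi, hBi⟩ := hB
    have hs : s = {i} := by
      refine Finset.eq_singleton_iff_unique_mem.2 ⟨hi, fun j hj => ?_⟩
      by_contra hji
      exact hcross j hj i hi hji (by simp [hBi])
    simp [hs, hBi]
  push Not at hB
  rcases s.eq_empty_or_nonempty with rfl | ⟨i₀, hi₀⟩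
  · simp
  have hXpos : (0 : ℚ) < X.card := by
    obtain ⟨x, hx⟩ := hB i₀ hi₀
    exact_mod_cast Finset.card_pos.2 ⟨x, hX i₀ hi₀ (Finset.mem_union_right _ hx)⟩
  have hstep : ∀ x ∈ X, ∑ i ∈ s with x ∉ A i,
      (((A i).card + ((B i).erase x).card).choose (A i).card : ℚ)⁻¹ ≤ 1 := by
    intro x hx
    refine ih (X.erase x) (Finset.erase_ssubset hx) _ (fun i => (B i).erase x) ?_ ?_ ?_
    · intro i hi
      exact (hdisj i (Finset.mem_filter.1 hi).1).mono_right (Finset.erase_subset _ _)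
    · intro i hi j hj hij hd
      rw [Finset.mem_filter] at hi hj
      refine hcross i hi.1 j hj.1 hij (Finset.disjoint_left.2 fun y hyA hyB => ?_)
      exact Finset.disjoint_left.1 hd hyA
        (Finset.mem_erase.2 ⟨fun h => hi.2 (h ▸ hyA), hyB⟩)
    · intro i hi y hy
      rw [Finset.mem_filter] at hi
      have := hX i hi.1
      grind
  have hweight : ∀ i ∈ s, ∑ x ∈ X with x ∉ A i,
      (((A i).card + ((B i).erase x).card).choose (A i).card : ℚ)⁻¹ =
        X.card * (((A i).card + (B i).card).choose (A i).card : ℚ)⁻¹ := by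
    intro i hi
    have hBX : B i ⊆ X := Finset.union_subset_right (hX i hi)
    have hd := hdisj i hi
    have hsplit : X.filter (fun x => x ∉ A i) = B i ∪ X \ (A i ∪ B i) := by
      ext x
      have : x ∈ B i → x ∈ X := fun hx => hBX hx
      have : x ∈ B i → x ∉ A i := fun hx => Finset.disjoint_right.1 hd hx
      grind
    have hcard : ((X \ (A i ∪ B i)).card : ℚ) = X.card - ((A i).card + (B i).card) := by
      rw [Finset.cast_card_sdiff (hX i hi), Finset.card_union_of_disjoint hd]
      push_cast
      ring
    rw [hsplit, Finset.sum_union (Finset.disjoint_left.2 (by grind)),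
      Finset.sum_congr rfl (fun x hx => by rw [Finset.card_erase_of_mem hx]),
      Finset.sum_congr (s₁ := X \ (A i ∪ B i)) rfl (fun x hx => by
        rw [Finset.erase_eq_of_notMem (by grind)]),
      Finset.sum_const, Finset.sum_const, nsmul_eq_mul, nsmul_eq_mul, hcard]
    obtain ⟨b, hb⟩ : ∃ b, (B i).card = b + 1 :=
      Nat.exists_eq_succ_of_ne_zero (Finset.card_pos.2 (hB i hi)).ne'
    rw [hb]
    set a := (A i).card
    have hrec : ((a + (b + 1)).choose a : ℚ) * (b + 1) = (a + b).choose a * (a + b + 1) := by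
      have := Nat.choose_mul_succ_eq (a + b) a
      rw [show a + b + 1 - a = b + 1 by omega] at this
      exact_mod_cast this.symm
    have h₁ : ((a + b).choose a : ℚ) ≠ 0 :=
      Nat.cast_ne_zero.2 (Nat.choose_pos (by omega)).ne'
    have h₂ : ((a + (b + 1)).choose a : ℚ) ≠ 0 :=
      Nat.cast_ne_zero.2 (Nat.choose_pos (by omega)).ne'
    rw [show b + 1 - 1 = b from rfl]
    push_cast
    field_simp
    linear_combination hrec
  have hsum : (X.card : ℚ) * ∑ i ∈ s, (((A i).card + (B i).card).choose (A i).card : ℚ)⁻¹ ≤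
      X.card * 1 := by
    rw [Finset.mul_sum, ← Finset.sum_congr rfl hweight, mul_one,
      Finset.sum_comm' (t' := X) (s' := fun x => s.filter fun i => x ∉ A i) (by grind)]
    calc _ ≤ ∑ x ∈ X, (1 : ℚ) := Finset.sum_le_sum hstep
      _ = X.card := by simp
  exact le_of_mul_le_mul_left hsum hXpos

/-- A rainbow matching may be indexed by any finite type. -/
theorem HasRainbow.of_fintype {V ι : Type*} [Fintype ι] {n : ℕ} {H : Fin n → Finset (Finset V)}
    (c : ι → Fin n) (e : ι → Finset V) (hc : Function.Injective c) (he : ∀ j, e j ∈ H (c j))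
    (hd : ∀ j k, j ≠ k → Disjoint (e j) (e k)) : HasRainbow H (Fintype.card ι) :=
  let φ := (Fintype.equivFin ι).symm
  ⟨c ∘ φ, e ∘ φ, hc.comp φ.injective, fun j => he (φ j),
    fun _ _ hjk => hd _ _ (φ.injective.ne hjk)⟩

/-- Exchanging one edge of a rainbow matching for two disjoint edges of two unused colours
produces a larger rainbow matching. -/
theorem HasRainbow.exchange {V : Type*} {n : ℕ} {H : Fin n → Finset (Finset V)}
    {M : Finset (Finset V)} (hM : ∀ g ∈ M, ∀ h ∈ M, g ≠ h → Disjoint g h)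
    {C : Finset (Fin n)} {col : Finset V → Fin n} (hcol : ∀ g ∈ M, col g ∈ C ∧ g ∈ H (col g))
    (hinj : Set.InjOn col ↑M) {e : Finset V} (he : e ∈ M) {i j : Fin n} (hi : i ∉ C) (hj : j ∉ C)
    (hij : i ≠ j) {f g : Finset V} (hf : f ∈ H i) (hg : g ∈ H j) (hfg : Disjoint f g)
    (hfe : (f : Set V) ∩ {v | ∃ h ∈ M, v ∈ h} ⊆ e)
    (hge : (g : Set V) ∩ {v | ∃ h ∈ M, v ∈ h} ⊆ e) : HasRainbow H (M.card + 1) := by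
  classical
  have hdisj : ∀ k : Finset V, (k : Set V) ∩ {v | ∃ h ∈ M, v ∈ h} ⊆ e →
      ∀ x : M.erase e, Disjoint k x := by
    rintro k hk ⟨x, hx⟩
    rw [Finset.mem_erase] at hx
    exact Finset.disjoint_left.2 fun v hvk hvx =>
      Finset.disjoint_left.1 (hM x hx.2 e he hx.1) hvx (hk ⟨hvk, x, hx.2, hvx⟩)
  have hmem : ∀ x : M.erase e, x.1 ∈ M := fun x => Finset.mem_of_mem_erase x.2
  have hcolC : ∀ x : M.erase e, col x ∈ C := fun x => (hcol x (hmem x)).1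
  have hcard : Fintype.card (Option (Option (M.erase e))) = M.card + 1 := by
    rw [Fintype.card_option, Fintype.card_option, Fintype.card_coe,
      Finset.card_erase_add_one he]
  rw [← hcard]
  refine HasRainbow.of_fintype
    (fun o => o.elim i fun o => o.elim j fun x => col x)
    (fun o => o.elim f fun o => o.elim g fun x => x) ?_ ?_ ?_
  · rintro (_ | _ | x) (_ | _ | y) h
    · rfl
    · exact absurd h hij
    · exact absurd (Eq.subst (motive := (· ∈ C)) h.symm (hcolC y)) hi
    · exact absurd h.symm hij
    · rfl
    · exact absurd (Eq.subst (motive := (· ∈ C)) h.symm (hcolC y)) hj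
    · exact absurd (Eq.subst (motive := (· ∈ C)) h (hcolC x)) hi
    · exact absurd (Eq.subst (motive := (· ∈ C)) h (hcolC x)) hj
    · rw [Subtype.ext (hinj (hmem x) (hmem y) h)]
  · rintro (_ | _ | x)
    · exact hf
    · exact hg
    · exact (hcol x (hmem x)).2
  · rintro (_ | _ | x) (_ | _ | y) h
    · exact absurd rfl h
    · exact hfg
    · exact hdisj f hfe y
    · exact hfg.symm
    · exact absurd rfl h
    · exact hdisj g hge y
    · exact (hdisj f hfe x).symm
    · exact (hdisj g hge x).symm
    · exact hM x (hmem x) y (hmem y) fun hxy => h (by rw [Subtype.ext hxy])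

/-- Claim 2.4: every edge e of a maximum rainbow matching M is good for at most
C(2r,r)/2 colours i outside the colour set C of M. -/
theorem stmt4 {V : Type*} (r n N m : ℕ) (hr : 2 ≤ r)
    (H : Fin n → Finset (Finset V))
    (hH : ∀ i, IsMatching r (H i) ∧ (H i).card = N)
    (M : Finset (Finset V)) (hMmatch : IsMatching r M) (hMcard : M.card = m)
    (C : Finset (Fin n)) (hCcard : C.card = m)
    (col : Finset V → Fin n)
    (hcol : ∀ e ∈ M, col e ∈ C ∧ e ∈ H (col e))
    (hinj : Set.InjOn col ↑M)
    (hmax : ∀ s, HasRainbow H s → s ≤ m) :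
    ∀ e ∈ M,
      2 * Set.ncard {i : Fin n | i ∉ C ∧ ∃ f₁ ∈ H i, ∃ f₂ ∈ H i, f₁ ≠ f₂ ∧
          ((f₁ : Set V) ∩ {v | ∃ g ∈ M, v ∈ g}) ⊆ (e : Set V) ∧
          ((f₂ : Set V) ∩ {v | ∃ g ∈ M, v ∈ g}) ⊆ (e : Set V)} ≤
        Nat.choose (2 * r) r := by
  classical
  intro e he
  set S := {i : Fin n | i ∉ C ∧ ∃ f₁ ∈ H i, ∃ f₂ ∈ H i, f₁ ≠ f₂ ∧
    ((f₁ : Set V) ∩ {v | ∃ g ∈ M, v ∈ g}) ⊆ (e : Set V) ∧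
    ((f₂ : Set V) ∩ {v | ∃ g ∈ M, v ∈ g}) ⊆ (e : Set V)}
  have hpair : ∀ i : S, ∃ F : Bool → Finset V, F true ≠ F false ∧ ∀ b, F b ∈ H i ∧
      ((F b : Set V) ∩ {v | ∃ g ∈ M, v ∈ g}) ⊆ (e : Set V) := by
    rintro ⟨i, -, f₁, hf₁, f₂, hf₂, hne, h₁, h₂⟩
    exact ⟨fun b => cond b f₁ f₂, hne, Bool.rec ⟨hf₂, h₂⟩ ⟨hf₁, h₁⟩⟩
  choose F hne hF using hpair
  have hcard : ∀ i b, (F i b).card = r := fun i b => (hH i).1.1 _ (hF i b).1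
  have hsum := sum_inv_choose_card_le_one (Finset.univ : Finset (S × Bool))
    (fun p => F p.1 p.2) (fun p => F p.1 !p.2) ?_ ?_
  · simp only [hcard, Finset.sum_const, Finset.card_univ, Fintype.card_prod, Fintype.card_bool,
      nsmul_eq_mul, ← two_mul] at hsum
    have hpos : (0 : ℚ) < (2 * r).choose r := Nat.cast_pos.2 (Nat.choose_pos (by omega))
    rw [← div_eq_mul_inv, div_le_one hpos] at hsum
    rw [← Nat.card_coe_set_eq, Nat.card_eq_fintype_card, mul_comm]
    exact_mod_cast hsum
  · rintro ⟨i, b⟩ -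
    refine (hH i).1.2 _ (hF i b).1 _ (hF i !b).1 ?_
    cases b
    · exact (hne i).symm
    · exact hne i
  · rintro ⟨i, b⟩ - ⟨j, b'⟩ - hij hd
    by_cases h : i = j
    · subst h
      have hb : b = !b' := by
        cases b <;> cases b' <;> simp_all
      simp only [← hb, disjoint_self, Finset.bot_eq_empty] at hd
      have := hcard i b
      simp only [hd, Finset.card_empty] at this
      omega
    · have := hmax _ (HasRainbow.exchange hMmatch.2 hcol hinj he i.2.1 j.2.1
        (fun hij => h (Subtype.ext hij)) (hF i b).1 (hF j !b').1 hd (hF i b).2 (hF j !b').2)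
      omega
end

section
/- Let r ≥ 2 and q, n be positive integers, and suppose that for each i ∈ {1,…,q} there exists an r-partite r-uniform hypergraph H_i and a collection of n matchings in H_i, each of size t_i, that does not admit a rainbow matching of size t_i. Then there exists an r-partite r-uniform hypergraph H and a collection of n matchings in H, each of size t_1 + ⋯ + t_q, that does not admit a rainbow matching of size t_1 + ⋯ + t_q − q + 1. -/
/-- The edges of the disjoint union of a family of hypergraphs, living on the sigma type. -/
noncomputable def sigmaEdges {ι : Type*} [Fintype ι] {V : ι → Type*}
    (A : ∀ i, Finset (Finset (V i))) : Finset (Finset (Σ i, V i)) := by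
  classical
  exact (Finset.univ.sigma A).image fun x => x.2.map (Function.Embedding.sigmaMk x.1)

theorem mem_sigmaEdges {ι : Type*} [Fintype ι] {V : ι → Type*}
    {A : ∀ i, Finset (Finset (V i))} {e : Finset (Σ i, V i)} :
    e ∈ sigmaEdges A ↔ ∃ i, ∃ f ∈ A i, f.map (Function.Embedding.sigmaMk i) = e := by
  classical
  simp [sigmaEdges]

theorem disjoint_map_sigmaMk_of_ne {ι : Type*} {V : ι → Type*} {i j : ι} (h : i ≠ j)
    (e : Finset (V i)) (f : Finset (V j)) :
    Disjoint (e.map (Function.Embedding.sigmaMk i)) (f.map (Function.Embedding.sigmaMk j)) := by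
  rw [Finset.disjoint_left]
  intro x hx hy
  obtain ⟨a, -, rfl⟩ := Finset.mem_map.1 hx
  obtain ⟨b, -, hb⟩ := Finset.mem_map.1 hy
  exact h (congrArg Sigma.fst hb).symm

theorem card_sigmaEdges {ι : Type*} [Fintype ι] {V : ι → Type*}
    {A : ∀ i, Finset (Finset (V i))} (hA : ∀ i, ∀ e ∈ A i, e.Nonempty) :
    (sigmaEdges A).card = ∑ i, (A i).card := by
  classical
  rw [sigmaEdges, Finset.card_image_of_injOn, Finset.card_sigma]
  rintro ⟨i, e⟩ he ⟨j, f⟩ - h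
  have he' : e ∈ A i := by simpa using he
  by_cases hij : i = j
  · subst hij
    exact congrArg (Sigma.mk i) (Finset.map_injective _ h)
  · have hd := disjoint_map_sigmaMk_of_ne hij e f
    dsimp only at h
    rw [← h, disjoint_self, Finset.bot_eq_empty, Finset.map_eq_empty] at hd
    exact absurd hd (hA i e he').ne_empty

theorem IsMatching.sigmaEdges {ι : Type*} [Fintype ι] {V : ι → Type*} {r : ℕ}
    {A : ∀ i, Finset (Finset (V i))} (hA : ∀ i, IsMatching r (A i)) :
    IsMatching r (sigmaEdges A) := by
  constructor
  · intro e he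
    obtain ⟨i, f, hf, rfl⟩ := mem_sigmaEdges.1 he
    rw [Finset.card_map, (hA i).1 f hf]
  · intro e he e' he' hne
    obtain ⟨i, f, hf, rfl⟩ := mem_sigmaEdges.1 he
    obtain ⟨j, g, hg, rfl⟩ := mem_sigmaEdges.1 he'
    by_cases hij : i = j
    · subst hij
      rw [Finset.disjoint_map]
      exact (hA i).2 f hf g hg fun h => hne (h ▸ rfl)
    · exact disjoint_map_sigmaMk_of_ne hij f g

theorem IsPartiteEdge.map_sigmaMk {ι : Type*} {V : ι → Type*} {r : ℕ} {P : ∀ i, V i → Fin r}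
    {i : ι} {e : Finset (V i)} (he : IsPartiteEdge r (P i) e) :
    IsPartiteEdge r (fun x : Σ i, V i => P x.1 x.2) (e.map (Function.Embedding.sigmaMk i)) := by
  intro k
  rw [Finset.filter_map, Finset.card_map]
  exact he k

/-- A rainbow matching of size `s` in a disjoint union contains a rainbow matching of size `t i`
in one of the pieces as soon as `s > ∑ i, (t i - 1)`. -/
theorem exists_hasRainbow_of_sigmaEdges {ι : Type*} [Fintype ι] {V : ι → Type*} {n s : ℕ}
    {M : ∀ i, Fin n → Finset (Finset (V i))} {t : ι → ℕ} (hs : ∑ i, (t i - 1) < s)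
    (h : HasRainbow (fun j => sigmaEdges fun i => M i j) s) :
    ∃ i, HasRainbow (M i) (t i) := by
  classical
  obtain ⟨c, e, hc, he, hd⟩ := h
  choose idx f hf hfe using fun j => mem_sigmaEdges.1 (he j)
  obtain ⟨i, hi⟩ : ∃ i, t i ≤ Fintype.card {j // idx j = i} := by
    by_contra! hlt
    have hcard : s = ∑ i, Fintype.card {j // idx j = i} := by
      rw [← Fintype.card_sigma, Fintype.card_congr (Equiv.sigmaFiberEquiv idx), Fintype.card_fin]
    have := Finset.sum_le_sum fun i (_ : i ∈ Finset.univ) => Nat.le_sub_one_of_lt (hlt i)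
    omega
  obtain ⟨g⟩ : Nonempty (Fin (t i) ↪ {j // idx j = i}) :=
    Function.Embedding.nonempty_of_card_le (by simpa using hi)
  have key : ∀ a, ∃ f' ∈ M i (c (g a)), f'.map (Function.Embedding.sigmaMk i) = e (g a) := by
    intro a
    obtain ⟨j, rfl⟩ := g a
    exact ⟨f j, hf j, hfe j⟩
  choose f' hf' hfe' using key
  refine ⟨i, fun a => c (g a), f', fun a b hab => g.injective (Subtype.ext (hc hab)), hf', ?_⟩
  intro a b hab
  rw [← Finset.disjoint_map (Function.Embedding.sigmaMk i), hfe', hfe']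
  exact hd _ _ fun h => hab (g.injective (Subtype.ext h))

/-- Lemma 2.6 (blow-up lemma): disjoint unions of counterexample collections give a
collection of n matchings of size t₁+⋯+t_q with no rainbow matching of size
t₁+⋯+t_q - q + 1. -/
theorem stmt5 (r q n : ℕ) (hr : 2 ≤ r) (hq : 1 ≤ q) (hn : 1 ≤ n) (t : Fin q → ℕ)
    (hyp : ∀ i : Fin q, ∃ (V : Type) (P : V → Fin r) (M : Fin n → Finset (Finset V)),
      (∀ j, IsMatching r (M j) ∧ (M j).card = t i ∧ ∀ e ∈ M j, IsPartiteEdge r P e) ∧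
      ¬ HasRainbow M (t i)) :
    ∃ (V : Type) (P : V → Fin r) (M : Fin n → Finset (Finset V)),
      (∀ j, IsMatching r (M j) ∧ (M j).card = ∑ i, t i ∧
        ∀ e ∈ M j, IsPartiteEdge r P e) ∧
      ¬ HasRainbow M ((∑ i, t i) - q + 1) := by
  choose V P M hM hR using hyp
  have ht : ∀ i, 1 ≤ t i := by
    intro i
    by_contra hi
    obtain hi : t i = 0 := by omega
    apply hR i
    rw [hi]
    exact ⟨Fin.elim0, Fin.elim0, fun a => a.elim0, fun a => a.elim0, fun a => a.elim0⟩
  refine ⟨Σ i, V i, fun x => P x.1 x.2, fun j => sigmaEdges fun i => M i j, fun j => ⟨?_, ?_, ?_⟩,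
    fun h => ?_⟩
  · exact IsMatching.sigmaEdges fun i => (hM i j).1
  · rw [card_sigmaEdges]
    · exact Finset.sum_congr rfl fun i _ => (hM i j).2.1
    · intro i e he
      have := (hM i j).1.1 e he
      exact Finset.card_pos.1 (by omega)
  · intro e he
    obtain ⟨i, f, hf, rfl⟩ := mem_sigmaEdges.1 he
    exact IsPartiteEdge.map_sigmaMk ((hM i j).2.2 f hf)
  · have hsum : ∑ i, (t i - 1) = (∑ i, t i) - q := by
      rw [Finset.sum_tsub_distrib _ fun i _ => ht i]
      simp
    obtain ⟨i, hi⟩ := exists_hasRainbow_of_sigmaEdges (t := t) (by omega) h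
    exact hR i hi
end

section
/- For every integer r ≥ 3 and every positive integer n, every collection of n matchings, each of size ⌈(r+1)n/2⌉, in an r-uniform hypergraph admits a rainbow matching of size at least n − 2^r·√n (i.e., of size at least ⌈n − 2^r·√n⌉). -/
open Finset in
/-- A weak form of the Bollobás set-pair inequality. -/
theorem card_le_four_pow_of_cross_intersecting {ι V : Type*} (S : Finset ι)
    (F G : ι → Finset V) (r : ℕ) (hF : ∀ i ∈ S, (F i).card = r) (hG : ∀ i ∈ S, (G i).card = r)
    (hFG : ∀ i ∈ S, Disjoint (F i) (G i))
    (hcross : ∀ i ∈ S, ∀ j ∈ S, i ≠ j → ¬ Disjoint (F i) (G j)) : S.card ≤ 4 ^ r := by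
  classical
  rcases S.eq_empty_or_nonempty with rfl | ⟨i₀, hi₀⟩
  · simp
  set U := S.biUnion fun i => F i ∪ G i with hU
  have hsub : ∀ i ∈ S, F i ∪ G i ⊆ U := fun i hi => subset_biUnion_of_mem (fun i => F i ∪ G i) hi
  have hFU : ∀ i ∈ S, F i ⊆ U \ G i := fun i hi => by
    rw [subset_sdiff]
    exact ⟨subset_union_left.trans (hsub i hi), hFG i hi⟩
  have hcard : ∀ i ∈ S, (Icc (F i) (U \ G i)).card = 2 ^ (U.card - 2 * r) := fun i hi => by
    rw [card_Icc_finset (hFU i hi), card_sdiff_of_subset (subset_union_right.trans (hsub i hi)),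
      hF i hi, hG i hi]
    congr 1
    omega
  have h2r : 2 * r ≤ U.card := by
    have h := card_le_card (hsub i₀ hi₀)
    rw [card_union_of_disjoint (hFG i₀ hi₀), hF i₀ hi₀, hG i₀ hi₀] at h
    omega
  have hdisj : ∀ i ∈ S, ∀ j ∈ S, i ≠ j →
      Disjoint (Icc (F i) (U \ G i)) (Icc (F j) (U \ G j)) := fun i hi j hj hij => by
    rw [Finset.disjoint_left]
    intro X hX hX'
    rw [mem_Icc] at hX hX'
    exact hcross i hi j hj hij ((subset_sdiff.1 (hX.1.trans hX'.2)).2)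
  have hle : (S.biUnion fun i => Icc (F i) (U \ G i)).card ≤ U.powerset.card := by
    refine card_le_card fun X hX => ?_
    obtain ⟨i, -, hX⟩ := mem_biUnion.1 hX
    exact mem_powerset.2 ((mem_Icc.1 hX).2.trans sdiff_subset)
  rw [card_biUnion hdisj, sum_congr rfl hcard, sum_const, smul_eq_mul, card_powerset] at hle
  have hpow : 2 ^ U.card = 4 ^ r * 2 ^ (U.card - 2 * r) := by
    rw [show (4 : ℕ) = 2 ^ 2 by norm_num, ← pow_mul, ← pow_add]
    congr 1
    omega
  rw [hpow] at hle
  exact Nat.le_of_mul_le_mul_right hle (by positivity)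

open Finset in
theorem sum_card_inter_le_of_pairwise_disjoint {V : Type*} [DecidableEq V]
    (A : Finset (Finset V)) (W : Finset V)
    (hA : ∀ e ∈ A, ∀ f ∈ A, e ≠ f → Disjoint e f) : ∑ f ∈ A, (f ∩ W).card ≤ W.card := by
  rw [← card_biUnion fun e he f hf hef =>
    (hA e he f hf hef).mono inter_subset_left inter_subset_left]
  exact card_le_card (biUnion_subset.2 fun f _ => inter_subset_right)

/-- `e` chooses, for each colour in `C`, an edge of that colour so that the chosen edges are
pairwise disjoint. -/
def IsRainbowOn {V : Type*} {n : ℕ} (M : Fin n → Finset (Finset V)) (C : Finset (Fin n))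
    (e : Fin n → Finset V) : Prop :=
  (∀ i ∈ C, e i ∈ M i) ∧ ∀ i ∈ C, ∀ j ∈ C, i ≠ j → Disjoint (e i) (e j)

theorem IsRainbowOn.hasRainbow {V : Type*} {n : ℕ} {M : Fin n → Finset (Finset V)}
    {C : Finset (Fin n)} {e : Fin n → Finset V} (h : IsRainbowOn M C e) :
    HasRainbow M C.card := by
  refine ⟨fun k => C.equivFin.symm k, fun k => e (C.equivFin.symm k), ?_, ?_, ?_⟩
  · exact Subtype.val_injective.comp C.equivFin.symm.injective
  · exact fun k => h.1 _ (C.equivFin.symm k).2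
  · refine fun j k hjk => h.2 _ (C.equivFin.symm j).2 _ (C.equivFin.symm k).2 fun heq => hjk ?_
    exact C.equivFin.symm.injective (Subtype.val_injective heq)

theorem IsRainbowOn.mono {V : Type*} {n : ℕ} {M : Fin n → Finset (Finset V)}
    {C D : Finset (Fin n)} {e : Fin n → Finset V} (h : IsRainbowOn M C e) (hD : D ⊆ C) :
    IsRainbowOn M D e :=
  ⟨fun i hi => h.1 i (hD hi), fun i hi j hj => h.2 i (hD hi) j (hD hj)⟩

theorem IsRainbowOn.insert_update {V : Type*} {n : ℕ} {M : Fin n → Finset (Finset V)}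
    {C : Finset (Fin n)} {e : Fin n → Finset V} (h : IsRainbowOn M C e) {i : Fin n} (hi : i ∉ C)
    {f : Finset V} (hf : f ∈ M i) (hd : ∀ j ∈ C, Disjoint f (e j)) :
    IsRainbowOn M (insert i C) (Function.update e i f) := by
  have hne : ∀ j ∈ C, j ≠ i := fun j hj hji => hi (hji ▸ hj)
  constructor
  · intro j hj
    rcases Finset.mem_insert.1 hj with rfl | hj
    · simpa using hf
    · rw [Function.update_of_ne (hne j hj)]
      exact h.1 j hj
  · intro j hj k hk hjk
    rcases Finset.mem_insert.1 hj with rfl | hjC <;> rcases Finset.mem_insert.1 hk with rfl | hkC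
    · exact absurd rfl hjk
    · rw [Function.update_self, Function.update_of_ne (hne k hkC)]
      exact hd k hkC
    · rw [Function.update_self, Function.update_of_ne (hne j hjC)]
      exact (hd j hjC).symm
    · rw [Function.update_of_ne (hne k hkC), Function.update_of_ne (hne j hjC)]
      exact h.2 j hjC k hkC hjk

theorem exists_isRainbowOn_card_max {V : Type*} {n : ℕ} (M : Fin n → Finset (Finset V)) :
    ∃ C e, IsRainbowOn M C e ∧ ∀ C' e', IsRainbowOn M C' e' → C'.card ≤ C.card := by
  classical
  obtain ⟨C, hC, hmax⟩ := Finset.exists_max_image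
    (Finset.univ.filter fun C => ∃ e, IsRainbowOn M C e) Finset.card
    ⟨∅, Finset.mem_filter.2 ⟨Finset.mem_univ _, fun _ => ∅, by simp [IsRainbowOn]⟩⟩
  obtain ⟨e, he⟩ := (Finset.mem_filter.1 hC).2
  exact ⟨C, e, he, fun C' e' h => hmax C' (by simpa using ⟨e', h⟩)⟩

open Finset in
/-- An edge that meets the union of the disjoint sets `e k` in a single vertex meets at most one
of them. -/
theorem disjoint_of_card_inter_biUnion_eq_one {ι V : Type*} [DecidableEq V] {C : Finset ι}
    {e : ι → Finset V} {f : Finset V} (hf : (f ∩ C.biUnion e).card = 1) {j l : ι}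
    (hj : j ∈ C) (hl : l ∈ C) (hjl : Disjoint (e j) (e l)) (hfj : ¬ Disjoint f (e j)) :
    Disjoint f (e l) := by
  by_contra hfl
  obtain ⟨x, hxf, hxj⟩ := Finset.not_disjoint_iff.1 hfj
  obtain ⟨y, hyf, hyl⟩ := Finset.not_disjoint_iff.1 hfl
  have hxy : x = y := card_le_one.1 hf.le x
    (mem_inter.2 ⟨hxf, mem_biUnion.2 ⟨j, hj, hxj⟩⟩) y
    (mem_inter.2 ⟨hyf, mem_biUnion.2 ⟨l, hl, hyl⟩⟩)
  exact Finset.disjoint_left.1 hjl hxj (hxy ▸ hyl)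

/-- The edges of `A` that meet the matching `e` on `C` in exactly one vertex, lying in `e j`. -/
def privateEdges {ι V : Type*} [DecidableEq V] (C : Finset ι) (e : ι → Finset V)
    (A : Finset (Finset V)) (j : ι) : Finset (Finset V) :=
  A.filter fun f => (f ∩ C.biUnion e).card = 1 ∧ ¬ Disjoint f (e j)

open Finset in
/-- In a rainbow matching of maximum size, few missing colours have two private edges at the same
edge of the matching. -/
theorem card_filter_privateEdges_le {V : Type*} [DecidableEq V] {r n : ℕ}
    {M : Fin n → Finset (Finset V)} (hM : ∀ i, IsMatching r (M i)) {C : Finset (Fin n)}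
    {e : Fin n → Finset V} (he : IsRainbowOn M C e)
    (hmax : ∀ C' e', IsRainbowOn M C' e' → C'.card ≤ C.card) {j : Fin n} (hj : j ∈ C) :
    (Cᶜ.filter fun i => 2 ≤ (privateEdges C e (M i) j).card).card ≤ 4 ^ r := by
  set S := Cᶜ.filter fun i => 2 ≤ (privateEdges C e (M i) j).card
  have hpair : ∀ i : Fin n, ∃ f g : Finset V, i ∈ S →
      f ∈ privateEdges C e (M i) j ∧ g ∈ privateEdges C e (M i) j ∧ f ≠ g := by
    intro i
    by_cases hi : i ∈ S
    · obtain ⟨f, g, hf, hg, hfg⟩ := one_lt_card_iff.1 (mem_filter.1 hi).2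
      exact ⟨f, g, fun _ => ⟨hf, hg, hfg⟩⟩
    · exact ⟨∅, ∅, fun h => absurd h hi⟩
  choose F G hFG using hpair
  have hmemF i (hi : i ∈ S) := mem_filter.1 (hFG i hi).1
  have hmemG i (hi : i ∈ S) := mem_filter.1 (hFG i hi).2.1
  refine card_le_four_pow_of_cross_intersecting S F G r
    (fun i hi => (hM i).1 _ (hmemF i hi).1) (fun i hi => (hM i).1 _ (hmemG i hi).1)
    (fun i hi => (hM i).2 _ (hmemF i hi).1 _ (hmemG i hi).1 (hFG i hi).2.2) ?_
  intro i hi k hk hik hdisj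
  have hiC : i ∉ C := mem_compl.1 (mem_filter.1 hi).1
  have hkC : k ∉ C := mem_compl.1 (mem_filter.1 hk).1
  have hd : ∀ {f : Finset V}, ((f ∩ C.biUnion e).card = 1 ∧ ¬ Disjoint f (e j)) →
      ∀ l ∈ C.erase j, Disjoint f (e l) := fun hf l hl =>
    disjoint_of_card_inter_biUnion_eq_one hf.1 hj (mem_of_mem_erase hl)
      (he.2 j hj l (mem_of_mem_erase hl) (ne_of_mem_erase hl).symm) hf.2
  have hkC' : k ∉ C.erase j := fun h => hkC (mem_of_mem_erase h)
  have hiC' : i ∉ insert k (C.erase j) := by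
    simp [hik, hiC]
  have h₁ := (he.mono (erase_subset j C)).insert_update hkC' (hmemG k hk).1 (hd (hmemG k hk).2)
  have h₂ := h₁.insert_update hiC' (hmemF i hi).1 fun l hl => by
    rcases mem_insert.1 hl with rfl | hl
    · simpa using hdisj
    · rw [Function.update_of_ne (ne_of_mem_of_not_mem hl hkC')]
      exact hd (hmemF i hi).2 l hl
  have hcard := hmax _ _ h₂
  rw [card_insert_of_notMem hiC', card_insert_of_notMem hkC', card_erase_of_mem hj] at hcard
  have := card_pos.2 ⟨j, hj⟩
  omega

open Finset in
/-- In a rainbow matching of maximum size, a large missing colour has two private edges at many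
edges of the matching. -/
theorem two_mul_card_le_of_maximal {V : Type*} [DecidableEq V] {r n : ℕ} (hr : 1 ≤ r)
    {M : Fin n → Finset (Finset V)} (hM : ∀ i, IsMatching r (M i)) {C : Finset (Fin n)}
    {e : Fin n → Finset V} (he : IsRainbowOn M C e)
    (hmax : ∀ C' e', IsRainbowOn M C' e' → C'.card ≤ C.card) {i : Fin n} (hi : i ∉ C) :
    2 * (M i).card ≤ (r + 1) * C.card +
      (r - 1) * (C.filter fun j => 2 ≤ (privateEdges C e (M i) j).card).card := by
  set W := C.biUnion e with hW
  have hmeet : ∀ f ∈ M i, 1 ≤ (f ∩ W).card := by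
    intro f hf
    by_contra! hlt
    have hfW : Disjoint f W := by
      rw [disjoint_iff_inter_eq_empty, ← card_eq_zero]
      omega
    have h := hmax _ _ (he.insert_update hi hf fun j hj =>
      hfW.mono_right (subset_biUnion_of_mem e hj))
    rw [card_insert_of_notMem hi] at h
    omega
  have hWcard : W.card ≤ r * C.card := by
    rw [mul_comm]
    exact card_biUnion_le_card_mul _ _ _ fun j hj => ((hM j).1 _ (he.1 j hj)).le
  have hsum := (sum_card_inter_le_of_pairwise_disjoint (M i) W (hM i).2).trans hWcard
  have hprivate : 2 * (M i).card ≤ ((M i).filter fun f => (f ∩ W).card = 1).card +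
      ∑ f ∈ M i, (f ∩ W).card := by
    rw [card_filter, ← sum_add_distrib, mul_comm, ← smul_eq_mul, ← sum_const]
    refine sum_le_sum fun f hf => ?_
    have := hmeet f hf
    split_ifs <;> omega
  have hcover : ((M i).filter fun f => (f ∩ W).card = 1).card ≤
      ∑ j ∈ C, (privateEdges C e (M i) j).card := by
    refine (card_le_card fun f hf => ?_).trans card_biUnion_le
    obtain ⟨hfM, hf1⟩ := mem_filter.1 hf
    obtain ⟨x, hx⟩ := card_pos.1 (hf1.symm ▸ Nat.one_pos)
    obtain ⟨hxf, hxW⟩ := mem_inter.1 hx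
    obtain ⟨j, hj, hxj⟩ := mem_biUnion.1 hxW
    exact mem_biUnion.2 ⟨j, hj, mem_filter.2 ⟨hfM, hf1, not_disjoint_iff.2 ⟨x, hxf, hxj⟩⟩⟩
  have hdeg : ∀ j ∈ C, (privateEdges C e (M i) j).card ≤ r := by
    intro j hj
    have h := sum_card_inter_le_of_pairwise_disjoint (privateEdges C e (M i) j) (e j)
      fun f hf g hg => (hM i).2 f (mem_filter.1 hf).1 g (mem_filter.1 hg).1
    rw [(hM j).1 _ (he.1 j hj)] at h
    refine le_trans ?_ h
    rw [card_eq_sum_ones]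
    refine sum_le_sum fun f hf => Nat.one_le_iff_ne_zero.2 fun h0 => ?_
    exact (mem_filter.1 hf).2.2 (disjoint_iff_inter_eq_empty.2 (card_eq_zero.1 h0))
  have hbound : ∑ j ∈ C, (privateEdges C e (M i) j).card ≤ C.card +
      (r - 1) * (C.filter fun j => 2 ≤ (privateEdges C e (M i) j).card).card := by
    rw [card_filter, mul_sum, card_eq_sum_ones, ← sum_add_distrib]
    refine sum_le_sum fun j hj => ?_
    have := hdeg j hj
    split_ifs <;> omega
  linarith

open Finset in
/-- The number of colours missing from a maximum rainbow matching. -/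
theorem sq_card_compl_le_of_maximal {V : Type*} {r n : ℕ} (hr : 1 ≤ r)
    {M : Fin n → Finset (Finset V)} (hM : ∀ i, IsMatching r (M i))
    (hcard : ∀ i, (r + 1) * n ≤ 2 * (M i).card) {C : Finset (Fin n)}
    {e : Fin n → Finset V} (he : IsRainbowOn M C e)
    (hmax : ∀ C' e', IsRainbowOn M C' e' → C'.card ≤ C.card) :
    Cᶜ.card ^ 2 ≤ 4 ^ r * n := by
  classical
  have hn : C.card + Cᶜ.card = n := by simp
  have hmany : ∀ i ∈ Cᶜ, (r + 1) * Cᶜ.card ≤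
      (r - 1) * (C.filter fun j => 2 ≤ (privateEdges C e (M i) j).card).card := by
    intro i hi
    have h := (hcard i).trans (two_mul_card_le_of_maximal hr hM he hmax (mem_compl.1 hi))
    have hmul : (r + 1) * C.card + (r + 1) * Cᶜ.card = (r + 1) * n := by rw [← mul_add, hn]
    omega
  have hfew : ∀ j ∈ C, (Cᶜ.filter fun i => 2 ≤ (privateEdges C e (M i) j).card).card ≤ 4 ^ r :=
    fun j hj => card_filter_privateEdges_le hM he hmax hj
  have hdouble :
      ∑ i ∈ Cᶜ, (C.filter fun j => 2 ≤ (privateEdges C e (M i) j).card).card =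
        ∑ j ∈ C, (Cᶜ.filter fun i => 2 ≤ (privateEdges C e (M i) j).card).card :=
    sum_card_bipartiteAbove_eq_sum_card_bipartiteBelow
      fun i j => 2 ≤ (privateEdges C e (M i) j).card
  have hlow := card_nsmul_le_sum _ _ _ hmany
  have hup := sum_le_card_nsmul _ _ _ hfew
  rw [← mul_sum, hdouble, smul_eq_mul] at hlow
  rw [smul_eq_mul] at hup
  have hle : (r + 1) * Cᶜ.card ^ 2 ≤ (r + 1) * (4 ^ r * n) :=
    calc (r + 1) * Cᶜ.card ^ 2 = Cᶜ.card * ((r + 1) * Cᶜ.card) := by ring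
      _ ≤ (r - 1) * (C.card * 4 ^ r) := hlow.trans (Nat.mul_le_mul_left _ hup)
      _ ≤ (r + 1) * (n * 4 ^ r) := by
          gcongr <;> omega
      _ = (r + 1) * (4 ^ r * n) := by ring
  exact Nat.le_of_mul_le_mul_left hle r.succ_pos

/-- Lemma 2.8: every collection of n matchings of size ⌈(r+1)n/2⌉ in an r-uniform
hypergraph contains a rainbow matching of size at least n - 2^r·√n. -/
theorem stmt7 {V : Type*} (r n : ℕ) (hr : 3 ≤ r) (hn : 1 ≤ n)
    (M : Fin n → Finset (Finset V))
    (hM : ∀ i, IsMatching r (M i) ∧ (M i).card = ((r + 1) * n + 1) / 2) :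
    ∃ s : ℕ, HasRainbow M s ∧ (s : ℝ) ≥ (n : ℝ) - 2 ^ r * Real.sqrt n := by
  obtain ⟨C, e, he, hmax⟩ := exists_isRainbowOn_card_max M
  refine ⟨C.card, he.hasRainbow, ?_⟩
  have hsq := sq_card_compl_le_of_maximal (by omega) (fun i => (hM i).1)
    (fun i => by rw [(hM i).2]; omega) he hmax
  have hn' : C.card + Cᶜ.card = n := by simp
  have hcompl : (Cᶜ.card : ℝ) ≤ 2 ^ r * Real.sqrt n := by
    refine abs_le_of_sq_le_sq' ?_ (by positivity) |>.2
    rw [mul_pow, Real.sq_sqrt n.cast_nonneg, ← pow_mul, mul_comm r 2, pow_mul]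
    norm_num
    exact_mod_cast hsq
  have hcast : (C.card : ℝ) + Cᶜ.card = n := by exact_mod_cast hn'
  linarith
end

section
/- For every integer n ≥ 2, there exists a bipartite graph (equivalently, a 2-partite 2-uniform hypergraph) and a collection of n matchings in it, each of size n, such that every rainbow matching has size at most n − 1. (Construction: let M and M' be the two edge-disjoint perfect matchings of a cycle C_{2n}, take M_i = M for 1 ≤ i ≤ n−1 and M_n = M'.) -/
/-- The edge joining `a` on the left side to `a + d` on the right side. -/
def shiftEdge {n : ℕ} (d a : ZMod n) : Finset (ZMod n × Fin 2) := {(a, 0), (a + d, 1)}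

/-- The perfect matching formed by all edges of shift `d`. -/
def shiftMatching {n : ℕ} [NeZero n] (d : ZMod n) : Finset (Finset (ZMod n × Fin 2)) :=
  Finset.univ.image (shiftEdge d)

theorem mem_shiftEdge {n : ℕ} {d a : ZMod n} {v : ZMod n × Fin 2} :
    v ∈ shiftEdge d a ↔ v = (a, 0) ∨ v = (a + d, 1) := by
  simp [shiftEdge]

theorem card_shiftEdge {n : ℕ} (d a : ZMod n) : (shiftEdge d a).card = 2 :=
  Finset.card_pair (by simp)

theorem shiftEdge_injective {n : ℕ} (d : ZMod n) : Function.Injective (shiftEdge d) := by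
  intro a b h
  have ha : (a, (0 : Fin 2)) ∈ shiftEdge d b := h ▸ mem_shiftEdge.2 (Or.inl rfl)
  simpa [mem_shiftEdge] using ha

theorem disjoint_shiftEdge {n : ℕ} (d : ZMod n) {a b : ZMod n} (h : a ≠ b) :
    Disjoint (shiftEdge d a) (shiftEdge d b) := by
  simp [shiftEdge, h.symm]

theorem isPartiteEdge_shiftEdge {n : ℕ} (d a : ZMod n) :
    IsPartiteEdge 2 Prod.snd (shiftEdge d a) := by
  intro k
  fin_cases k <;> simp [shiftEdge, Finset.filter_insert, Finset.filter_singleton]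

theorem isMatching_shiftMatching {n : ℕ} [NeZero n] (d : ZMod n) :
    IsMatching 2 (shiftMatching d) := by
  simp only [IsMatching, shiftMatching, Finset.forall_mem_image]
  exact ⟨fun a _ => card_shiftEdge d a, fun a _ b _ hab =>
    disjoint_shiftEdge d fun h => hab (congrArg _ h)⟩

theorem card_shiftMatching {n : ℕ} [NeZero n] (d : ZMod n) : (shiftMatching d).card = n := by
  rw [shiftMatching, Finset.card_image_of_injective _ (shiftEdge_injective d), Finset.card_univ,
    ZMod.card]

/-- If exactly the colour `i₀` has shift `1` and all the others have shift `0`, then no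
rainbow matching uses every colour. -/
theorem not_hasRainbow_shiftMatching {n : ℕ} [NeZero n] (hn : 2 ≤ n) (i₀ : Fin n) :
    ¬ HasRainbow (fun i => shiftMatching (if i = i₀ then (1 : ZMod n) else 0)) n := by
  rintro ⟨c, e, hc, he, hd⟩
  simp only [shiftMatching, Finset.mem_image, Finset.mem_univ, true_and] at he
  choose f hf using he
  have hinj : Function.Injective f := by
    intro j k hjk
    by_contra hne
    refine Finset.not_disjoint_iff.2 ⟨(f j, 0), ?_, ?_⟩ (hd j k hne)
    · rw [← hf j]; exact mem_shiftEdge.2 (Or.inl rfl)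
    · rw [← hf k, hjk]; exact mem_shiftEdge.2 (Or.inl rfl)
  have hsurj : Function.Surjective f :=
    ((Fintype.bijective_iff_injective_and_card f).2 ⟨hinj, by simp [ZMod.card]⟩).2
  obtain ⟨j, hj⟩ := Finite.surjective_of_injective hc i₀
  obtain ⟨k, hk⟩ := hsurj (f j + 1)
  have : Fact (1 < n) := ⟨hn⟩
  have hjk : j ≠ k := by
    rintro rfl
    simp at hk
  have hck : c k ≠ i₀ := fun h => hjk (hc (hj.trans h.symm))
  refine Finset.not_disjoint_iff.2 ⟨(f j + 1, 1), ?_, ?_⟩ (hd j k hjk)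
  · rw [← hf j, if_pos hj]; exact mem_shiftEdge.2 (Or.inr rfl)
  · rw [← hf k, if_neg hck, hk]; exact mem_shiftEdge.2 (Or.inr (by simp))

/-- Sharpness of Conjecture 1.1: there are n matchings of size n in a bipartite graph
with no rainbow matching of size n. -/
theorem stmt10 (n : ℕ) (hn : 2 ≤ n) :
    ∃ (V : Type) (P : V → Fin 2) (M : Fin n → Finset (Finset V)),
      (∀ i, IsMatching 2 (M i) ∧ (M i).card = n ∧ ∀ e ∈ M i, IsPartiteEdge 2 P e) ∧
      ∀ s : ℕ, HasRainbow M s → s ≤ n - 1 := by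
  have : NeZero n := ⟨by omega⟩
  refine ⟨ZMod n × Fin 2, Prod.snd,
    fun i => shiftMatching (if i = 0 then (1 : ZMod n) else 0), fun i => ?_, fun s hs => ?_⟩
  · refine ⟨isMatching_shiftMatching _, card_shiftMatching _, ?_⟩
    simp only [shiftMatching, Finset.forall_mem_image]
    exact fun a _ => isPartiteEdge_shiftEdge _ a
  · have hle : s ≤ n := by
      obtain ⟨c, -, hc, -⟩ := hs
      simpa using Fintype.card_le_of_injective c hc
    have hne : s ≠ n := by
      rintro rfl
      exact not_hasRainbow_shiftMatching hn 0 hs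
    omega
end

section
/- For every odd integer n ≥ 3, there exists a graph and a collection of n matchings in it, each of size n + 1, that does not admit a rainbow matching of size n. (Construction: take the disjoint union of (n+1)/2 copies of a properly 3-edge-coloured K_4 with colours red, green, blue; let M_1, …, M_{n−2} be copies of the red matching, M_{n−1} the green matching, and M_n the blue matching.) -/
/-- The two edges of colour `d` in a proper 3-edge-colouring of `K₄`. -/
def coloredEdge (d : Fin 3) (s : Bool) : Finset (Fin 4) :=
  match d, s with
  | 0, false => {0, 1}
  | 0, true => {2, 3}
  | 1, false => {0, 2}
  | 1, true => {1, 3}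
  | 2, false => {0, 3}
  | 2, true => {1, 2}

theorem card_coloredEdge : ∀ d s, (coloredEdge d s).card = 2 := by decide

theorem disjoint_coloredEdge_iff :
    ∀ d s d' s', Disjoint (coloredEdge d s) (coloredEdge d' s') ↔ d = d' ∧ s ≠ s' := by
  decide

/-- The edge `coloredEdge d p.2` placed in the copy of `K₄` indexed by `p.1`. -/
def copyEdge {ι : Type*} (d : Fin 3) (p : ι × Bool) : Finset (ι × Fin 4) :=
  {p.1} ×ˢ coloredEdge d p.2

theorem card_copyEdge {ι : Type*} (d : Fin 3) (p : ι × Bool) : (copyEdge d p).card = 2 := by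
  simp [copyEdge, card_coloredEdge]

theorem disjoint_copyEdge_iff {ι : Type*} (d d' : Fin 3) (p q : ι × Bool) :
    Disjoint (copyEdge d p) (copyEdge d' q) ↔ p.1 ≠ q.1 ∨ (d = d' ∧ p.2 ≠ q.2) := by
  rw [copyEdge, copyEdge, Finset.disjoint_product, disjoint_coloredEdge_iff,
    Finset.disjoint_singleton]

theorem disjoint_copyEdge {ι : Type*} (d : Fin 3) {p q : ι × Bool} (h : p ≠ q) :
    Disjoint (copyEdge d p) (copyEdge d q) := by
  rw [disjoint_copyEdge_iff]
  by_contra! hc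
  exact h (Prod.ext hc.1 (hc.2 rfl))

theorem copyEdge_injective {ι : Type*} (d : Fin 3) :
    Function.Injective (copyEdge (ι := ι) d) := by
  intro p q h
  by_contra hne
  have hd := disjoint_copyEdge d hne
  rw [← h, disjoint_self, Finset.bot_eq_empty] at hd
  simpa [hd] using card_copyEdge d p

/-- The matching formed by all edges of colour `d` in a disjoint union of copies of `K₄`. -/
def colorClass (ι : Type*) [Fintype ι] (d : Fin 3) : Finset (Finset (ι × Fin 4)) :=
  Finset.univ.map ⟨copyEdge d, copyEdge_injective d⟩

theorem mem_colorClass {ι : Type*} [Fintype ι] {d : Fin 3} {e : Finset (ι × Fin 4)} :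
    e ∈ colorClass ι d ↔ ∃ p, copyEdge d p = e := by
  simp [colorClass]

theorem isMatching_colorClass (ι : Type*) [Fintype ι] (d : Fin 3) :
    IsMatching 2 (colorClass ι d) := by
  simp only [IsMatching, mem_colorClass]
  refine ⟨?_, ?_⟩
  · rintro _ ⟨p, rfl⟩
    exact card_copyEdge d p
  · rintro _ ⟨p, rfl⟩ _ ⟨q, rfl⟩ h
    exact disjoint_copyEdge d fun hpq => h (congrArg _ hpq)

theorem card_colorClass (ι : Type*) [Fintype ι] (d : Fin 3) :
    (colorClass ι d).card = Fintype.card ι * 2 := by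
  simp [colorClass]

/-- If two edges of a family of pairwise disjoint edges have colours used only once in the family,
then the partners of these two edges are unused, so the family leaves out at least two edges. -/
theorem card_add_two_le_of_disjoint_copyEdge {ι κ : Type*} [Fintype ι] [Fintype κ]
    (d : κ → Fin 3) (p : κ → ι × Bool)
    (hdisj : ∀ j k, j ≠ k → Disjoint (copyEdge (d j) (p j)) (copyEdge (d k) (p k)))
    {a b : κ} (hab : a ≠ b) (ha : ∀ k, d k = d a → k = a) (hb : ∀ k, d k = d b → k = b) :
    Fintype.card κ + 2 ≤ Fintype.card ι * 2 := by
  classical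
  have hinj : Function.Injective p := by
    intro j k h
    by_contra hne
    have := hdisj j k hne
    rw [disjoint_copyEdge_iff, h] at this
    simp at this
  have partner : ∀ x, (∀ k, d k = d x → k = x) →
      ((p x).1, !(p x).2) ∉ Finset.univ.image p := by
    intro x hx hmem
    obtain ⟨k, -, hk⟩ := Finset.mem_image.1 hmem
    have hkx : k ≠ x := by
      rintro rfl
      simpa using congrArg Prod.snd hk
    have := hdisj k x hkx
    rw [disjoint_copyEdge_iff, hk] at this
    exact hkx (hx k (this.resolve_left (by simp)).1)
  have hne : ((p a).1, !(p a).2) ≠ ((p b).1, !(p b).2) := by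
    intro h
    simp only [Prod.mk.injEq, Bool.not_inj_iff] at h
    exact hab (hinj (Prod.ext h.1 h.2))
  have hcard := Finset.card_le_univ
    (insert ((p a).1, !(p a).2) (insert ((p b).1, !(p b).2) (Finset.univ.image p)))
  rw [Finset.card_insert_of_notMem (by
      rw [Finset.mem_insert, not_or]; exact ⟨hne, partner a ha⟩),
    Finset.card_insert_of_notMem (partner b hb),
    Finset.card_image_of_injective _ hinj] at hcard
  simp only [Finset.card_univ, Fintype.card_prod, Fintype.card_bool] at hcard
  exact hcard

/-- Sharpness of Conjecture 1.4: for odd n ≥ 3 there are n matchings of size n + 1 in a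
graph with no rainbow matching of size n. -/
theorem stmt11 (n : ℕ) (hn : 3 ≤ n) (hodd : Odd n) :
    ∃ (V : Type) (M : Fin n → Finset (Finset V)),
      (∀ i, IsMatching 2 (M i) ∧ (M i).card = n + 1) ∧
      ¬ HasRainbow M n := by
  obtain ⟨m, rfl⟩ := hodd
  let col : Fin (2 * m + 1) → Fin 3 := fun i => if i.1 = 0 then 1 else if i.1 = 1 then 2 else 0
  refine ⟨Fin (m + 1) × Fin 4, fun i => colorClass (Fin (m + 1)) (col i),
    fun i => ⟨isMatching_colorClass _ _, ?_⟩, ?_⟩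
  · rw [card_colorClass, Fintype.card_fin]
    ring
  · rintro ⟨c, e, hc, he, hdisj⟩
    choose p hp using fun j => mem_colorClass.1 (he j)
    have hsurj := Finite.surjective_of_injective hc
    obtain ⟨a, ha⟩ := hsurj ⟨0, by omega⟩
    obtain ⟨b, hb⟩ := hsurj ⟨1, by omega⟩
    have hcol_zero : ∀ i, col i = 1 → i.1 = 0 := by
      intro i
      simp only [col]
      split_ifs <;> simp_all
    have hcol_one : ∀ i, col i = 2 → i.1 = 1 := by
      intro i
      simp only [col]
      split_ifs <;> simp_all
    have hle := card_add_two_le_of_disjoint_copyEdge (fun j => col (c j)) p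
      (fun j k hjk => by simpa only [hp] using hdisj j k hjk) (a := a) (b := b)
      (by rintro rfl; simp [ha] at hb)
      (fun k hk => hc (Fin.ext (by rw [hcol_zero _ (hk.trans (by simp [ha, col])), ha])))
      (fun k hk => hc (Fin.ext (by rw [hcol_one _ (hk.trans (by simp [hb, col])), hb])))
    simp only [Fintype.card_fin] at hle
    omega
end

section
/- Let r ≥ 2, let H_1, …, H_n be matchings, each of size N, in an r-uniform hypergraph, and let M be a rainbow matching of maximum size m using a set C ⊆ {1,…,n} of m colours. Then for every index i ∉ C, every edge of H_i intersects the vertex set V(M) of M, and the number h_i of edges of H_i intersecting V(M) in exactly one vertex satisfies h_i ≥ 2N − r·m. -/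
theorem hasRainbow_card {V : Type*} {n : ℕ} {H : Fin n → Finset (Finset V)}
    {S : Finset (Finset V)} (col : Finset V → Fin n) (hcol : ∀ e ∈ S, e ∈ H (col e))
    (hinj : Set.InjOn col ↑S) (hdisj : ∀ e ∈ S, ∀ f ∈ S, e ≠ f → Disjoint e f) :
    HasRainbow H S.card := by
  let φ := S.equivFin.symm
  refine ⟨fun j => col (φ j), fun j => φ j, fun j k h => ?_, fun j => hcol _ (φ j).2,
    fun j k h => hdisj _ (φ j).2 _ (φ k).2 fun h' => h (φ.injective (Subtype.ext h'))⟩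
  exact φ.injective (Subtype.ext (hinj (φ j).2 (φ k).2 h))

theorem hasRainbow_card_add_one {V : Type*} {n : ℕ} {H : Fin n → Finset (Finset V)}
    {S : Finset (Finset V)} (col : Finset V → Fin n) (hcol : ∀ e ∈ S, e ∈ H (col e))
    (hinj : Set.InjOn col ↑S) (hdisj : ∀ e ∈ S, ∀ f ∈ S, e ≠ f → Disjoint e f)
    {i : Fin n} (hi : ∀ e ∈ S, col e ≠ i) {f : Finset V} (hf : f ∈ H i) (hfS : f ∉ S)
    (hfdisj : ∀ e ∈ S, Disjoint f e) : HasRainbow H (S.card + 1) := by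
  classical
  have hne : ∀ e ∈ S, e ≠ f := fun e he h => hfS (h ▸ he)
  have hupd : ∀ e ∈ S, Function.update col f i e = col e := fun e he =>
    Function.update_of_ne (hne e he) _ _
  rw [← Finset.card_insert_of_notMem hfS]
  refine hasRainbow_card (Function.update col f i) ?_ ?_ ?_
  · intro e he
    obtain rfl | he := Finset.mem_insert.1 he
    · simpa using hf
    · rw [hupd e he]
      exact hcol e he
  · intro e he g hg h
    obtain rfl | heS := Finset.mem_insert.1 he <;> obtain rfl | hgS := Finset.mem_insert.1 hg
    · rfl
    · rw [hupd g hgS, Function.update_self] at h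
      exact absurd h.symm (hi g hgS)
    · rw [hupd e heS, Function.update_self] at h
      exact absurd h (hi e heS)
    · rw [hupd e heS, hupd g hgS] at h
      exact hinj heS hgS h
  · intro e he g hg h
    obtain rfl | heS := Finset.mem_insert.1 he <;> obtain rfl | hgS := Finset.mem_insert.1 hg
    · exact absurd rfl h
    · exact hfdisj g hgS
    · exact (hfdisj e heS).symm
    · exact hdisj e heS g hgS h

/-- If pairwise disjoint sets all meet `U`, then those meeting `U` only once
number at least twice the total minus `U.card`. -/
theorem two_mul_card_le_card_filter_add_card {V : Type*} [DecidableEq V]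
    {A : Finset (Finset V)} {U : Finset V} (hA : ∀ e ∈ A, ∀ f ∈ A, e ≠ f → Disjoint e f)
    (hU : ∀ f ∈ A, (f ∩ U).Nonempty) :
    2 * A.card ≤ (A.filter fun f => (f ∩ U).card = 1).card + U.card := by
  have hsum : ∑ f ∈ A, (f ∩ U).card ≤ U.card := by
    rw [← Finset.card_biUnion fun e he f hf h =>
      (hA e he f hf h).mono Finset.inter_subset_left Finset.inter_subset_left]
    exact Finset.card_le_card (Finset.biUnion_subset.2 fun _ _ => Finset.inter_subset_right)
  calc 2 * A.card = ∑ f ∈ A, 2 := by simp [mul_comm]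
    _ ≤ ∑ f ∈ A, ((if (f ∩ U).card = 1 then 1 else 0) + (f ∩ U).card) := by
      refine Finset.sum_le_sum fun f hf => ?_
      have := (hU f hf).card_pos
      split_ifs <;> omega
    _ ≤ _ := by
      rw [Finset.sum_add_distrib, ← Finset.card_filter]
      gcongr

/-- First part of the proof of Claim 2.3: for every unused colour i, every edge of H_i
meets V(M), and the number h_i of edges of H_i meeting V(M) in exactly one vertex
satisfies h_i ≥ 2N - rm. -/
theorem stmt13 {V : Type*} (r n N m : ℕ) (hr : 2 ≤ r)
    (H : Fin n → Finset (Finset V))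
    (hH : ∀ i, IsMatching r (H i) ∧ (H i).card = N)
    (M : Finset (Finset V)) (hMmatch : IsMatching r M) (hMcard : M.card = m)
    (C : Finset (Fin n)) (hCcard : C.card = m)
    (col : Finset V → Fin n)
    (hcol : ∀ e ∈ M, col e ∈ C ∧ e ∈ H (col e))
    (hinj : Set.InjOn col ↑M)
    (hmax : ∀ s, HasRainbow H s → s ≤ m) :
    ∀ i : Fin n, i ∉ C →
      (∀ f ∈ H i, ((f : Set V) ∩ {v | ∃ g ∈ M, v ∈ g}).Nonempty) ∧
      (Set.ncard {f : Finset V | f ∈ H i ∧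
          ((f : Set V) ∩ {v | ∃ g ∈ M, v ∈ g}).ncard = 1} : ℤ) ≥
        2 * N - (r : ℤ) * m := by
  classical
  intro i hi
  have hmeet : ∀ f ∈ H i, ((f : Set V) ∩ {v | ∃ g ∈ M, v ∈ g}).Nonempty := by
    intro f hf
    by_contra hempty
    have hfdisj : ∀ g ∈ M, Disjoint f g := fun g hg =>
      Finset.disjoint_left.2 fun v hvf hvg => hempty ⟨v, hvf, g, hg, hvg⟩
    have hfM : f ∉ M := by
      intro hfM
      have hcard := (hH i).1.1 f hf
      rw [disjoint_self.1 (hfdisj f hfM), Finset.bot_eq_empty, Finset.card_empty] at hcard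
      omega
    have := hmax _ (hasRainbow_card_add_one col (fun e he => (hcol e he).2) hinj hMmatch.2
      (fun e he (h : col e = i) => hi (h ▸ (hcol e he).1)) hf hfM hfdisj)
    omega
  refine ⟨hmeet, ?_⟩
  set U : Finset V := M.biUnion id with hU
  have hinter : ∀ f : Finset V,
      (f : Set V) ∩ {v | ∃ g ∈ M, v ∈ g} = ((f ∩ U : Finset V) : Set V) := by
    intro f
    ext v
    simp [hU]
  have hUcard : U.card ≤ m * r := by
    rw [← hMcard]
    exact Finset.card_biUnion_le_card_mul _ _ _ fun e he => (hMmatch.1 e he).le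
  have hset : {f : Finset V | f ∈ H i ∧ ((f : Set V) ∩ {v | ∃ g ∈ M, v ∈ g}).ncard = 1} =
      (((H i).filter fun f => (f ∩ U).card = 1 : Finset (Finset V)) : Set (Finset V)) := by
    ext f
    rw [Set.mem_ofPred_eq, hinter, Set.ncard_coe_finset, Finset.mem_coe, Finset.mem_filter]
  have hcount := two_mul_card_le_card_filter_add_card (hH i).1.2 (U := U) fun f hf => by
    have := hmeet f hf
    rwa [hinter, Finset.coe_nonempty] at this
  rw [hset, Set.ncard_coe_finset]
  rw [(hH i).2] at hcount
  have hle := hcount.trans (Nat.add_le_add_left hUcard _)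
  generalize ((H i).filter fun f => (f ∩ U).card = 1).card = k at hle ⊢
  zify at hle
  linarith
end
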